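/- Let (u, p) be a smooth solution of the steady Navier-Stokes equations on ℝ⁴ \ {0} with |u(x)| ≤ C/|x| for all x ≠ 0. Then ∇u is square integrable on ℝ⁴, i.e. ∫_{ℝ⁴} |∇u(x)|² dx < ∞. -/

import Mathlib

namespace SteadyNS

open MeasureTheory Filter Topology
open scoped ContDiff

/-- Four-dimensional Euclidean space. -/
abbrev E4 := EuclideanSpace ℝ (Fin 4)

/-- The `i`-th partial derivative. -/
noncomputable def pd (i : Fin 4) (f : E4 → ℝ) : E4 → ℝ :=
  fun x => fderiv ℝ f x (EuclideanSpace.single i 1)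

@[fun_prop]
lemma contDiff_pd (i : Fin 4) {f : E4 → ℝ} (hf : ContDiff ℝ ∞ f) : ContDiff ℝ ∞ (pd i f) := by
  have h : ContDiff ℝ ∞ (fderiv ℝ f) := hf.fderiv_right (by simp)
  exact h.clm_apply contDiff_const

lemma pd_add {i : Fin 4} {f g : E4 → ℝ} (hf : ContDiff ℝ ∞ f) (hg : ContDiff ℝ ∞ g) :
    pd i (fun x => f x + g x) = fun x => pd i f x + pd i g x := by
  ext x
  have h1 := (hf.differentiable (by simp)) x
  have h2 := (hg.differentiable (by simp)) x
  simp [pd, fderiv_fun_add h1 h2]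

lemma pd_sub {i : Fin 4} {f g : E4 → ℝ} (hf : ContDiff ℝ ∞ f) (hg : ContDiff ℝ ∞ g) :
    pd i (fun x => f x - g x) = fun x => pd i f x - pd i g x := by
  ext x
  have h1 := (hf.differentiable (by simp)) x
  have h2 := (hg.differentiable (by simp)) x
  simp [pd, fderiv_fun_sub h1 h2]

lemma pd_mul {i : Fin 4} {f g : E4 → ℝ} (hf : ContDiff ℝ ∞ f) (hg : ContDiff ℝ ∞ g) :
    pd i (fun x => f x * g x) = fun x => pd i f x * g x + f x * pd i g x := by
  ext x
  have h1 := (hf.differentiable (by simp)) x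
  have h2 := (hg.differentiable (by simp)) x
  simp [pd, fderiv_fun_mul h1 h2]
  ring

@[simp]
lemma pd_const (i : Fin 4) (c : ℝ) : pd i (fun _ => c) = fun _ => 0 := by
  ext x
  simp [pd]

lemma pd_const_mul {i : Fin 4} (c : ℝ) {f : E4 → ℝ} (hf : ContDiff ℝ ∞ f) :
    pd i (fun x => c * f x) = fun x => c * pd i f x := by
  rw [pd_mul contDiff_const hf]
  simp

lemma pd_sum {i : Fin 4} {ι : Type*} {s : Finset ι} {f : ι → E4 → ℝ}
    (hf : ∀ k ∈ s, ContDiff ℝ ∞ (f k)) :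
    pd i (fun x => ∑ k ∈ s, f k x) = fun x => ∑ k ∈ s, pd i (f k) x := by
  ext x
  have h : ∀ k ∈ s, DifferentiableAt ℝ (f k) x := fun k hk =>
    ((hf k hk).differentiable (by simp)) x
  simp [pd, fderiv_fun_sum h]

lemma pd_comm (i j : Fin 4) {f : E4 → ℝ} (hf : ContDiff ℝ ∞ f) :
    pd i (pd j f) = pd j (pd i f) := by
  ext x
  have h : ContDiff ℝ ∞ (fderiv ℝ f) := hf.fderiv_right (by simp)
  have hd := h.differentiable (by simp) x
  have key : ∀ v w : E4, fderiv ℝ (fun y => fderiv ℝ f y v) x w = fderiv ℝ (fderiv ℝ f) x w v := by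
    intro v w
    rw [fderiv_clm_apply hd (differentiableAt_const v)]
    simp
  have hs : IsSymmSndFDerivAt ℝ f x := by
    apply (hf.contDiffAt (x := x)).isSymmSndFDerivAt
    simpa using WithTop.coe_le_coe.2 (le_top : (2 : ℕ∞) ≤ ⊤)
  unfold pd
  rw [key, key]
  exact hs _ _

lemma pd_congr {i : Fin 4} {f g : E4 → ℝ} {x : E4} (h : f =ᶠ[𝓝 x] g) : pd i f x = pd i g x := by
  simp [pd, h.fderiv_eq]

lemma pd_congr_nhds {i : Fin 4} {f g : E4 → ℝ} {x : E4} (h : f =ᶠ[𝓝 x] g) :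
    pd i f =ᶠ[𝓝 x] pd i g := by
  filter_upwards [h.eventuallyEq_nhds] with y hy using pd_congr hy

lemma pd_congr_on {i : Fin 4} {f g : E4 → ℝ} {S : Set E4} (hS : IsOpen S)
    (h : ∀ x ∈ S, f x = g x) : ∀ x ∈ S, pd i f x = pd i g x := fun x hx =>
  pd_congr (by filter_upwards [hS.mem_nhds hx] with y hy using h y hy)

lemma tsupport_pd_subset (i : Fin 4) (f : E4 → ℝ) : tsupport (pd i f) ⊆ tsupport f := by
  refine (closure_mono ?_).trans (tsupport_fderiv_subset ℝ (f := f))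
  intro x hx hx'
  apply hx
  simp [pd, hx']

lemma hasCompactSupport_pd (i : Fin 4) {f : E4 → ℝ} (hf : HasCompactSupport f) :
    HasCompactSupport (pd i f) :=
  hf.fderiv_apply ℝ _

lemma pd_comp_smul (i : Fin 4) (f : E4 → ℝ) (r : ℝ) (x : E4) :
    pd i (fun y => f (r • y)) x = r * pd i f (r • x) := by
  simp only [pd]
  rw [fderiv_comp_smul]
  simp

lemma pd_comp_sub (i : Fin 4) {f : E4 → ℝ} (hf : ContDiff ℝ ∞ f) (x : E4) :
    pd i (fun y => f (x - y)) = fun y => - pd i f (x - y) := by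
  ext y
  simp only [pd]
  have h1 := (hf.differentiable (by simp)) (x - y)
  have h2 : HasFDerivAt (fun y : E4 => x - y) (-ContinuousLinearMap.id ℝ E4) y :=
    (hasFDerivAt_id y).const_sub x
  have := (h1.hasFDerivAt.comp y h2).fderiv
  simp only [Function.comp_def] at this
  simp [this]

lemma integral_pd_eq_zero (i : Fin 4) {f : E4 → ℝ} (hf : ContDiff ℝ ∞ f)
    (hc : HasCompactSupport f) : ∫ x, pd i f x = 0 := by
  have hfi : Integrable f := hf.continuous.integrable_of_hasCompactSupport hc
  have hdi : Integrable (pd i f) :=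
    (contDiff_pd i hf).continuous.integrable_of_hasCompactSupport (hasCompactSupport_pd i hc)
  have := integral_mul_fderiv_eq_neg_fderiv_mul_of_integrable (μ := (volume : Measure E4))
    (f := fun _ : E4 => (1 : ℝ)) (g := f) (v := EuclideanSpace.single i 1) (by simp)
    (by simpa [pd] using! hdi) (by simpa using hfi) (fun x _ => differentiableAt_const _)
    (fun x _ => (hf.differentiable (by simp)) x)
  simpa [pd] using this

lemma integral_mul_pd (i : Fin 4) {f g : E4 → ℝ} (hf : ContDiff ℝ ∞ f) (hg : ContDiff ℝ ∞ g)
    (hc : HasCompactSupport g) : ∫ x, f x * pd i g x = - ∫ x, pd i f x * g x := by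
  have h0 := integral_pd_eq_zero i (hf.mul hg) hc.mul_left
  have h1 : Integrable (fun x => pd i f x * g x) :=
    ((contDiff_pd i hf).mul hg).continuous.integrable_of_hasCompactSupport hc.mul_left
  have h2 : Integrable (fun x => f x * pd i g x) :=
    (hf.mul (contDiff_pd i hg)).continuous.integrable_of_hasCompactSupport
      (hasCompactSupport_pd i hc).mul_left
  rw [pd_mul hf hg, integral_add h1 h2] at h0
  linarith

lemma ae_ne_zero : ∀ᵐ x : E4, x ≠ 0 := by simp [ae_iff]

lemma locallyIntegrable_of_abs_le {f : E4 → ℝ} {C : ℝ} {k : ℕ} (hk : k < 4)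
    (hf : Measurable f) (h : ∀ x, x ≠ 0 → |f x| ≤ C / ‖x‖ ^ k) : LocallyIntegrable f := by
  refine locallyIntegrable_of_norm_le_rpow (μ := (volume : Measure E4)) (C := C) (α := k)
    (by simp) (by simpa using hk) ?_ hf.aestronglyMeasurable
  filter_upwards [ae_ne_zero] with x hx
  rw [Real.rpow_neg (norm_nonneg _), Real.rpow_natCast, ← div_eq_mul_inv]
  exact h x hx

lemma contDiff_integral_mul_comp_sub {N h : E4 → ℝ} (hN : LocallyIntegrable N)
    (hh : ContDiff ℝ ∞ h) (hc : HasCompactSupport h) :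
    ContDiff ℝ ∞ (fun x => ∫ y, N y * h (x - y)) :=
  hc.contDiff_convolution_right (ContinuousLinearMap.mul ℝ ℝ) hN hh

lemma pd_integral_mul_comp_sub (i : Fin 4) {N h : E4 → ℝ} (hN : LocallyIntegrable N)
    (hh : ContDiff ℝ ∞ h) (hc : HasCompactSupport h) :
    pd i (fun x => ∫ y, N y * h (x - y)) = fun x => ∫ y, N y * pd i h (x - y) := by
  ext x
  have h1 : ContDiff ℝ 1 h := hh.of_le (by simp)
  have := (hc.hasFDerivAt_convolution_right (ContinuousLinearMap.mul ℝ ℝ) hN h1 x).fderiv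
  have h2 : (fun x => ∫ y, N y * h (x - y)) =
    convolution N h (ContinuousLinearMap.mul ℝ ℝ) volume := rfl
  rw [pd, h2, this, convolution_precompR_apply _ hN (hc.fderiv ℝ) (h1.continuous_fderiv (by simp))]
  rfl

lemma pd_inv {i : Fin 4} {f : E4 → ℝ} (hf : ContDiff ℝ ∞ f) (h0 : ∀ x, f x ≠ 0) :
    pd i (fun x => (f x)⁻¹) = fun x => - (pd i f x * ((f x)⁻¹ * (f x)⁻¹)) := by
  have hg : ContDiff ℝ ∞ (fun x => (f x)⁻¹) := hf.inv h0
  have h1 : pd i (fun x => f x * (f x)⁻¹) = fun _ => 0 := by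
    have : (fun x => f x * (f x)⁻¹) = fun _ => (1 : ℝ) := by
      ext x; exact mul_inv_cancel₀ (h0 x)
    rw [this, pd_const]
  rw [pd_mul hf hg] at h1
  ext x
  have h2 := congrFun h1 x
  have h3 := h0 x
  field_simp at h2 ⊢
  linarith

lemma contDiff_coord (i : Fin 4) : ContDiff ℝ ∞ (fun x : E4 => x i) := by fun_prop

lemma pd_coord (i j : Fin 4) : pd i (fun x : E4 => x j) = fun _ => if j = i then 1 else 0 := by
  ext x
  have : HasFDerivAt (fun x : E4 => x j) (EuclideanSpace.proj (𝕜 := ℝ) j) x :=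
    (EuclideanSpace.proj (𝕜 := ℝ) j).hasFDerivAt
  simp [pd, this.fderiv]

lemma contDiff_normSq : ContDiff ℝ ∞ (fun x : E4 => ‖x‖ ^ 2) := contDiff_norm_sq ℝ

lemma normSq_eq_sum (x : E4) : ‖x‖ ^ 2 = ∑ i, x i * x i := by
  rw [EuclideanSpace.norm_sq_eq]
  exact Finset.sum_congr rfl fun i _ => by rw [Real.norm_eq_abs, sq_abs, sq]

lemma pd_normSq (i : Fin 4) : pd i (fun x : E4 => ‖x‖ ^ 2) = fun x => 2 * x i := by
  have : (fun x : E4 => ‖x‖ ^ 2) = fun x => ∑ j, x j * x j := by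
    ext x; exact normSq_eq_sum x
  rw [this, pd_sum (fun k _ => (contDiff_coord k).mul (contDiff_coord k))]
  ext x
  have h : ∀ k : Fin 4, pd i (fun x : E4 => x k * x k) x = if k = i then 2 * x i else 0 := by
    intro k
    rw [pd_mul (contDiff_coord k) (contDiff_coord k), pd_coord]
    by_cases hk : k = i
    · subst hk; simp; ring
    · simp [hk]
  simp [h]

/-- The kernel `1 / (|x|² + d)`, a multiple of the regularised Newtonian potential. -/
noncomputable def regKer (d : ℝ) (x : E4) : ℝ := (‖x‖ ^ 2 + d)⁻¹

lemma regKer_pos_aux {d : ℝ} (hd : 0 < d) (x : E4) : 0 < ‖x‖ ^ 2 + d := by positivity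

lemma contDiff_regKer {d : ℝ} (hd : 0 < d) : ContDiff ℝ ∞ (regKer d) :=
  (contDiff_normSq.add contDiff_const).inv (fun x => (regKer_pos_aux hd x).ne')

lemma pd_regKer (i : Fin 4) {d : ℝ} (hd : 0 < d) :
    pd i (regKer d) = fun x => -2 * (x i * (regKer d x * regKer d x)) := by
  have h := pd_inv (i := i) (f := fun x : E4 => ‖x‖ ^ 2 + d) (contDiff_normSq.add contDiff_const)
    (fun x => (regKer_pos_aux hd x).ne')
  rw [pd_add contDiff_normSq contDiff_const, pd_normSq, pd_const] at h
  refine Eq.trans h ?_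
  ext x
  simp only [regKer]
  ring

lemma pd_pd_regKer (i : Fin 4) {d : ℝ} (hd : 0 < d) :
    pd i (pd i (regKer d)) = fun x => -2 * (regKer d x) ^ 2 + 8 * (x i * x i) * regKer d x ^ 3 := by
  have h := contDiff_regKer hd
  rw [pd_regKer i hd, pd_const_mul _ ((contDiff_coord i).mul (h.mul h)),
    pd_mul (contDiff_coord i) (h.mul h), pd_mul h h, pd_regKer i hd, pd_coord]
  ext x
  simp
  ring

lemma sum_pd_pd_regKer {d : ℝ} (hd : 0 < d) (x : E4) :
    ∑ i, pd i (pd i (regKer d)) x = - (8 * d * regKer d x ^ 3) := by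
  simp only [pd_pd_regKer _ hd, Finset.sum_add_distrib, ← Finset.sum_mul, ← Finset.mul_sum,
    ← normSq_eq_sum]
  have := regKer_pos_aux hd x
  simp [regKer]
  field_simp
  ring

/-- The fundamental kernel `|x|⁻²` of the Laplacian on `ℝ⁴`, up to normalisation. -/
noncomputable def newtonKer (x : E4) : ℝ := (‖x‖ ^ 2)⁻¹

/-- The gradient of `newtonKer`. -/
noncomputable def gradKer (i : Fin 4) (x : E4) : ℝ := -2 * (x i * (newtonKer x * newtonKer x))

lemma abs_coord_le (x : E4) (i : Fin 4) : |x i| ≤ ‖x‖ := by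
  simpa using PiLp.norm_apply_le x i

lemma regKer_nonneg {d : ℝ} (hd : 0 < d) (x : E4) : 0 ≤ regKer d x :=
  inv_nonneg.2 (regKer_pos_aux hd x).le

lemma regKer_le {d : ℝ} (hd : 0 < d) {x : E4} (hx : x ≠ 0) : regKer d x ≤ newtonKer x := by
  have : 0 < ‖x‖ := norm_pos_iff.2 hx
  exact inv_anti₀ (by positivity) (by linarith)

lemma measurable_newtonKer : Measurable newtonKer := by unfold newtonKer; fun_prop

lemma measurable_gradKer (i : Fin 4) : Measurable (gradKer i) := by
  unfold gradKer newtonKer; fun_prop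

lemma abs_newtonKer_le (x : E4) : |newtonKer x| ≤ 1 / ‖x‖ ^ 2 := by
  simp [newtonKer]

lemma abs_gradKer_le (i : Fin 4) {x : E4} (hx : x ≠ 0) : |gradKer i x| ≤ 2 / ‖x‖ ^ 3 := by
  have h0 : 0 < ‖x‖ := norm_pos_iff.2 hx
  have h1 : |gradKer i x| = 2 * |x i| * (‖x‖ ^ 4)⁻¹ := by
    simp [gradKer, newtonKer, abs_mul]
    ring
  have h2 : 2 / ‖x‖ ^ 3 = 2 * ‖x‖ * (‖x‖ ^ 4)⁻¹ := by field_simp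
  rw [h1, h2]
  gcongr
  exact abs_coord_le x i

lemma locallyIntegrable_newtonKer : LocallyIntegrable newtonKer :=
  locallyIntegrable_of_abs_le (C := 1) (k := 2) (by norm_num) measurable_newtonKer
    (fun x _ => abs_newtonKer_le x)

lemma locallyIntegrable_gradKer (i : Fin 4) : LocallyIntegrable (gradKer i) :=
  locallyIntegrable_of_abs_le (C := 2) (k := 3) (by norm_num) (measurable_gradKer i)
    (fun _ hx => abs_gradKer_le i hx)

lemma integrable_mul_comp_sub {N h : E4 → ℝ} (hN : LocallyIntegrable N)
    (hh : Continuous h) (hc : HasCompactSupport h) (x : E4) :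
    Integrable (fun y => N y * h (x - y)) :=
  hc.convolutionExists_right (ContinuousLinearMap.mul ℝ ℝ) hN hh x

/-- A sequence of regularisation parameters. -/
noncomputable def eps (n : ℕ) : ℝ := 1 / ((n : ℝ) + 1)

lemma eps_pos (n : ℕ) : 0 < eps n := by unfold eps; positivity

lemma tendsto_eps : Tendsto eps atTop (𝓝 0) := tendsto_one_div_add_atTop_nhds_zero_nat

lemma tendsto_regKer {x : E4} (hx : x ≠ 0) :
    Tendsto (fun n => regKer (eps n ^ 2) x) atTop (𝓝 (newtonKer x)) := by
  have : 0 < ‖x‖ := norm_pos_iff.2 hx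
  have h1 : Tendsto (fun n => ‖x‖ ^ 2 + eps n ^ 2) atTop (𝓝 (‖x‖ ^ 2)) := by
    simpa using (tendsto_const_nhds (x := ‖x‖ ^ 2)).add (tendsto_eps.pow 2)
  exact h1.inv₀ (by positivity)

lemma tendsto_integral_regKer {h : E4 → ℝ} (hh : Continuous h) (hc : HasCompactSupport h)
    (x : E4) : Tendsto (fun n => ∫ y, regKer (eps n ^ 2) y * h (x - y)) atTop
      (𝓝 (∫ y, newtonKer y * h (x - y))) := by
  refine tendsto_integral_of_dominated_convergence (fun y => |newtonKer y * h (x - y)|) ?_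
    (integrable_mul_comp_sub locallyIntegrable_newtonKer hh hc x).abs ?_ ?_
  · intro n
    have := (contDiff_regKer (pow_pos (eps_pos n) 2)).continuous
    exact Continuous.aestronglyMeasurable (by fun_prop)
  · intro n
    filter_upwards [ae_ne_zero] with y hy
    have h1 := regKer_nonneg (pow_pos (eps_pos n) 2) y
    have h2 := regKer_le (pow_pos (eps_pos n) 2) hy
    rw [Real.norm_eq_abs, abs_mul, abs_mul, abs_of_nonneg h1, abs_of_nonneg (h1.trans h2)]
    gcongr
  · filter_upwards [ae_ne_zero] with y hy
    exact (tendsto_regKer hy).mul_const _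

lemma tendsto_integral_pd_regKer (i : Fin 4) {h : E4 → ℝ} (hh : Continuous h)
    (hc : HasCompactSupport h) (x : E4) :
    Tendsto (fun n => ∫ y, pd i (regKer (eps n ^ 2)) y * h (x - y)) atTop
      (𝓝 (∫ y, gradKer i y * h (x - y))) := by
  refine tendsto_integral_of_dominated_convergence (fun y => |gradKer i y * h (x - y)|) ?_
    (integrable_mul_comp_sub (locallyIntegrable_gradKer i) hh hc x).abs ?_ ?_
  · intro n
    have := (contDiff_pd i (contDiff_regKer (pow_pos (eps_pos n) 2))).continuous
    exact Continuous.aestronglyMeasurable (by fun_prop)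
  · intro n
    filter_upwards [ae_ne_zero] with y hy
    have h1 := regKer_nonneg (pow_pos (eps_pos n) 2) y
    have h2 := regKer_le (pow_pos (eps_pos n) 2) hy
    have h3 := h1.trans h2
    rw [Real.norm_eq_abs, pd_regKer i (pow_pos (eps_pos n) 2)]
    simp only [gradKer, abs_mul, abs_of_nonneg h1, abs_of_nonneg (h1.trans h2)]
    gcongr
  · filter_upwards [ae_ne_zero] with y hy
    simp only [pd_regKer i (pow_pos (eps_pos _) 2), gradKer]
    have := tendsto_regKer hy
    exact (((this.mul this).const_mul _).const_mul _).mul_const _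

lemma contDiff_comp_sub {h : E4 → ℝ} (hh : ContDiff ℝ ∞ h) (x : E4) :
    ContDiff ℝ ∞ (fun y => h (x - y)) := hh.comp (contDiff_const.sub contDiff_id)

lemma hasCompactSupport_comp_sub {h : E4 → ℝ} (hc : HasCompactSupport h) (x : E4) :
    HasCompactSupport (fun y => h (x - y)) :=
  hc.comp_homeomorph (Homeomorph.subLeft x)

lemma integral_mul_pd_comp_sub (i : Fin 4) {N h : E4 → ℝ} (hN : ContDiff ℝ ∞ N)
    (hh : ContDiff ℝ ∞ h) (hc : HasCompactSupport h) (x : E4) :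
    ∫ y, N y * pd i h (x - y) = ∫ y, pd i N y * h (x - y) := by
  have := integral_mul_pd i hN (contDiff_comp_sub hh x) (hasCompactSupport_comp_sub hc x)
  rw [pd_comp_sub i hh] at this
  simp only [mul_neg, integral_neg, neg_inj] at this
  exact this

lemma integral_newtonKer_mul_pd (i : Fin 4) {h : E4 → ℝ}
    (hh : ContDiff ℝ ∞ h) (hc : HasCompactSupport h) (x : E4) :
    ∫ y, newtonKer y * pd i h (x - y) = ∫ y, gradKer i y * h (x - y) := by
  refine tendsto_nhds_unique
    (tendsto_integral_regKer (contDiff_pd i hh).continuous (hasCompactSupport_pd i hc) x) ?_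
  have := tendsto_integral_pd_regKer i hh.continuous hc x
  refine this.congr fun n => ?_
  rw [integral_mul_pd_comp_sub i (contDiff_regKer (pow_pos (eps_pos n) 2)) hh hc]

/-- The total mass of the approximate identity `-Δ (regKer d)`. -/
noncomputable def newtonMass : ℝ := ∫ z : E4, 8 * regKer 1 z ^ 3

lemma integrable_regKer_one_pow : Integrable (fun z : E4 => 8 * regKer 1 z ^ 3) := by
  have := integrable_rpow_neg_one_add_norm_sq (E := E4) (μ := volume) (r := 6) (by simp; norm_num)
  refine (this.const_mul 8).congr (Eventually.of_forall fun x => ?_)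
  simp only [regKer]
  rw [show (-6 / 2 : ℝ) = -((3 : ℕ) : ℝ) by norm_num, Real.rpow_neg (by positivity),
    Real.rpow_natCast, inv_pow, add_comm]

lemma newtonMass_pos : 0 < newtonMass := by
  have hpos : ∀ z : E4, 0 < 8 * regKer 1 z ^ 3 := fun z => by
    have : 0 < regKer 1 z := inv_pos.2 (regKer_pos_aux one_pos z)
    positivity
  refine (integral_pos_iff_support_of_nonneg (fun z => (hpos z).le) integrable_regKer_one_pow).2 ?_
  have : Function.support (fun z : E4 => 8 * regKer 1 z ^ 3) = Set.univ := by
    ext z; simpa using (hpos z).ne'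
  rw [this]
  simp

lemma integral_mollifier {h : E4 → ℝ} {d : ℝ} (hd : 0 < d) (x : E4) :
    ∫ y, 8 * d ^ 2 * regKer (d ^ 2) y ^ 3 * h (x - y) =
      ∫ z, 8 * regKer 1 z ^ 3 * h (x - d • z) := by
  have := Measure.integral_comp_smul_of_nonneg (volume : Measure E4)
    (fun y => 8 * d ^ 2 * regKer (d ^ 2) y ^ 3 * h (x - y)) d (hR := hd.le)
  simp only [finrank_euclideanSpace, Fintype.card_fin, smul_eq_mul] at this
  have h1 : ∫ y, 8 * d ^ 2 * regKer (d ^ 2) y ^ 3 * h (x - y) =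
      d ^ 4 * ∫ z : E4, 8 * d ^ 2 * regKer (d ^ 2) (d • z) ^ 3 * h (x - d • z) := by
    rw [this]; field_simp
  rw [h1, ← integral_const_mul]
  congr 1
  ext z
  have : regKer (d ^ 2) (d • z) = (d ^ 2)⁻¹ * regKer 1 z := by
    simp only [regKer, norm_smul, Real.norm_eq_abs, mul_pow, sq_abs]
    rw [← mul_inv]
    ring_nf
  rw [this]
  field_simp

lemma tendsto_integral_mollifier {h : E4 → ℝ} (hh : Continuous h) (hc : HasCompactSupport h)
    (x : E4) : Tendsto (fun n => ∫ y, 8 * eps n ^ 2 * regKer (eps n ^ 2) y ^ 3 * h (x - y)) atTop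
      (𝓝 (newtonMass * h x)) := by
  simp only [integral_mollifier (eps_pos _)]
  obtain ⟨B, hB⟩ := hc.exists_bound_of_continuous hh
  rw [newtonMass, ← integral_mul_const]
  refine tendsto_integral_of_dominated_convergence (fun z => 8 * regKer 1 z ^ 3 * B) ?_
    (integrable_regKer_one_pow.mul_const B) ?_ ?_
  · intro n
    have := (contDiff_regKer one_pos).continuous
    exact Continuous.aestronglyMeasurable (by fun_prop)
  · intro n
    refine Eventually.of_forall fun z => ?_
    have h1 := regKer_nonneg one_pos z
    rw [norm_mul, Real.norm_of_nonneg (by positivity)]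
    gcongr
    exact hB _
  · refine Eventually.of_forall fun z => ?_
    have h1 : Tendsto (fun n => x - eps n • z) atTop (𝓝 x) := by
      simpa using (tendsto_const_nhds (x := x)).sub (tendsto_eps.smul_const z)
    exact ((hh.tendsto x).comp h1).const_mul _

lemma integral_newtonKer_mul_laplacian {h : E4 → ℝ}
    (hh : ContDiff ℝ ∞ h) (hc : HasCompactSupport h) (x : E4) :
    ∑ i, ∫ y, newtonKer y * pd i (pd i h) (x - y) = - (newtonMass * h x) := by
  have h1 : Tendsto (fun n => ∑ i, ∫ y, regKer (eps n ^ 2) y * pd i (pd i h) (x - y)) atTop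
      (𝓝 (∑ i, ∫ y, newtonKer y * pd i (pd i h) (x - y))) :=
    tendsto_finsetSum _ fun i _ => tendsto_integral_regKer
      (contDiff_pd i (contDiff_pd i hh)).continuous
      (hasCompactSupport_pd i (hasCompactSupport_pd i hc)) x
  refine tendsto_nhds_unique h1 ((tendsto_integral_mollifier hh.continuous hc x).neg.congr ?_)
  intro n
  have hd : 0 < eps n ^ 2 := pow_pos (eps_pos n) 2
  have hN := contDiff_regKer hd
  have h2 : ∀ i, ∫ y, regKer (eps n ^ 2) y * pd i (pd i h) (x - y) =
      ∫ y, pd i (pd i (regKer (eps n ^ 2))) y * h (x - y) := fun i => by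
    rw [integral_mul_pd_comp_sub i hN (contDiff_pd i hh) (hasCompactSupport_pd i hc),
      integral_mul_pd_comp_sub i (contDiff_pd i hN) hh hc]
  simp only [h2]
  rw [← integral_finsetSum, ← integral_neg]
  · congr 1
    ext y
    rw [← Finset.sum_mul, sum_pd_pd_regKer hd]
    ring
  · intro i _
    exact integrable_mul_comp_sub (contDiff_pd i (contDiff_pd i hN)).continuous.locallyIntegrable
      hh.continuous hc x

/-- The solution `b` of `Δ b = h` given by the Newtonian potential. -/
noncomputable def newtonPot (h : E4 → ℝ) (x : E4) : ℝ :=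
  -newtonMass⁻¹ * ∫ y, newtonKer y * h (x - y)

lemma contDiff_newtonPot {h : E4 → ℝ} (hh : ContDiff ℝ ∞ h) (hc : HasCompactSupport h) :
    ContDiff ℝ ∞ (newtonPot h) :=
  contDiff_const.mul (contDiff_integral_mul_comp_sub locallyIntegrable_newtonKer hh hc)

lemma pd_newtonPot (i : Fin 4) {h : E4 → ℝ} (hh : ContDiff ℝ ∞ h) (hc : HasCompactSupport h) :
    pd i (newtonPot h) = newtonPot (pd i h) := by
  have := pd_const_mul (i := i) (-newtonMass⁻¹)
    (contDiff_integral_mul_comp_sub locallyIntegrable_newtonKer hh hc)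
  rw [pd_integral_mul_comp_sub i locallyIntegrable_newtonKer hh hc] at this
  exact this

lemma newtonPot_pd (i : Fin 4) {h : E4 → ℝ} (hh : ContDiff ℝ ∞ h) (hc : HasCompactSupport h)
    (x : E4) : newtonPot (pd i h) x = -newtonMass⁻¹ * ∫ y, gradKer i (x - y) * h y := by
  rw [newtonPot, integral_newtonKer_mul_pd i hh hc,
    ← integral_sub_left_eq_self (fun y => gradKer i (x - y) * h y) volume x]
  simp

lemma laplacian_newtonPot {h : E4 → ℝ} (hh : ContDiff ℝ ∞ h) (hc : HasCompactSupport h) (x : E4) :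
    ∑ i, pd i (pd i (newtonPot h)) x = h x := by
  have h1 : ∀ i, pd i (pd i (newtonPot h)) x = newtonPot (pd i (pd i h)) x := fun i => by
    rw [pd_newtonPot i hh hc, pd_newtonPot i (contDiff_pd i hh) (hasCompactSupport_pd i hc)]
  simp only [h1, newtonPot]
  rw [← Finset.mul_sum, integral_newtonKer_mul_laplacian hh hc]
  have := newtonMass_pos
  field_simp

lemma abs_gradKer_sub_le (i : Fin 4) {z w : E4} {s : ℝ} (hs : 0 < s) (hz : s ≤ ‖z‖)
    (hw : s ≤ ‖w‖) (hz' : ‖z‖ ≤ 4 * s) (hw' : ‖w‖ ≤ 4 * s) :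
    |gradKer i z - gradKer i w| ≤ 2050 * ‖z - w‖ / s ^ 4 := by
  have ha : 0 < ‖z‖ := hs.trans_le hz
  have hb : 0 < ‖w‖ := hs.trans_le hw
  have h1 : gradKer i z - gradKer i w = -2 * ((z i - w i) / ‖z‖ ^ 4) +
      -2 * (w i * ((‖w‖ - ‖z‖) * (‖w‖ + ‖z‖) * (‖w‖ ^ 2 + ‖z‖ ^ 2)) / (‖z‖ ^ 4 * ‖w‖ ^ 4)) := by
    simp only [gradKer, newtonKer]
    field_simp
    ring
  have h2 : |z i - w i| ≤ ‖z - w‖ := by simpa using abs_coord_le (z - w) i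
  have h3 : |‖w‖ - ‖z‖| ≤ ‖z - w‖ := by rw [norm_sub_rev]; exact abs_norm_sub_norm_le w z
  have h4 : |(z i - w i) / ‖z‖ ^ 4| ≤ ‖z - w‖ / s ^ 4 := by
    rw [abs_div, abs_of_pos (pow_pos ha 4)]
    gcongr
  have h5 : |w i * ((‖w‖ - ‖z‖) * (‖w‖ + ‖z‖) * (‖w‖ ^ 2 + ‖z‖ ^ 2)) / (‖z‖ ^ 4 * ‖w‖ ^ 4)| ≤
      1024 * ‖z - w‖ / s ^ 4 := by
    rw [abs_div, abs_mul, abs_mul, abs_mul, abs_of_pos (by positivity : 0 < ‖z‖ ^ 4 * ‖w‖ ^ 4),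
      abs_of_pos (by positivity : 0 < ‖w‖ + ‖z‖), abs_of_pos (by positivity : 0 < ‖w‖ ^ 2 + ‖z‖ ^ 2)]
    calc _ ≤ (4 * s) * (‖z - w‖ * (4 * s + 4 * s) * ((4 * s) ^ 2 + (4 * s) ^ 2)) /
          (s ^ 4 * s ^ 4) := by
          gcongr
          exact (abs_coord_le w i).trans hw'
      _ = _ := by field_simp; ring
  rw [h1]
  calc _ ≤ |-2 * ((z i - w i) / ‖z‖ ^ 4)| +
      |-2 * (w i * ((‖w‖ - ‖z‖) * (‖w‖ + ‖z‖) * (‖w‖ ^ 2 + ‖z‖ ^ 2)) / (‖z‖ ^ 4 * ‖w‖ ^ 4))| :=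
        abs_add_le _ _
    _ ≤ 2 * (‖z - w‖ / s ^ 4) + 2 * (1024 * ‖z - w‖ / s ^ 4) := by
        rw [abs_mul, abs_mul, abs_neg, abs_two]
        gcongr
    _ = _ := by ring

lemma integrable_indicator_ball {k : ℕ} (hk : k < 4) (R : ℝ) :
    Integrable ((Metric.ball (0 : E4) R).indicator (fun y => 1 / ‖y‖ ^ k)) := by
  have h : LocallyIntegrable (fun y : E4 => 1 / ‖y‖ ^ k) :=
    locallyIntegrable_of_abs_le (C := 1) hk (by fun_prop) (fun x _ => by
      rw [abs_of_nonneg (by positivity)])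
  refine (integrable_indicator_iff Metric.isOpen_ball.measurableSet).2 ?_
  exact (h.integrableOn_isCompact (isCompact_closedBall 0 R)).mono_set Metric.ball_subset_closedBall

lemma integrable_one_add_norm_pow_five : Integrable (fun y : E4 => 1 / (1 + ‖y‖) ^ 5) := by
  refine (integrable_one_add_norm (E := E4) (μ := volume) (r := 5) (by simp; norm_num)).congr
    (Eventually.of_forall fun x => ?_)
  simp only
  rw [show (-5 : ℝ) = -((5 : ℕ) : ℝ) by norm_num, Real.rpow_neg (by positivity),
    Real.rpow_natCast, one_div]

lemma integrable_gradKer_mul (i : Fin 4) {h : E4 → ℝ} (hh : Continuous h)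
    (hc : HasCompactSupport h) (x : E4) : Integrable (fun y => gradKer i (x - y) * h y) := by
  have := (integrable_mul_comp_sub (locallyIntegrable_gradKer i) hh hc x).comp_sub_left x
  simpa using this

lemma gradKer_mul_near (i : Fin 4) {x y : E4} (hx : 1 ≤ ‖x‖) (hy : y ≠ 0) (hxy : x - y ≠ 0) :
    |gradKer i (x - y)| * (1 / ‖y‖) ≤ 16 * (1 / ‖y‖) + 4 * (1 / ‖x - y‖ ^ 3) := by
  have hb : 0 < ‖y‖ := norm_pos_iff.2 hy
  have ha : 0 < ‖x - y‖ := norm_pos_iff.2 hxy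
  have h1 := abs_gradKer_le i hxy
  have h2 : ‖x‖ ≤ ‖x - y‖ + ‖y‖ := by simpa using norm_add_le (x - y) y
  rcases le_total (1 / 2) ‖x - y‖ with h | h
  · have h3 : 2 / ‖x - y‖ ^ 3 ≤ 16 := by
      rw [div_le_iff₀ (by positivity)]
      have : (1 / 2 : ℝ) ^ 3 ≤ ‖x - y‖ ^ 3 := by gcongr
      linarith
    have : |gradKer i (x - y)| * (1 / ‖y‖) ≤ 16 * (1 / ‖y‖) := by
      gcongr
      exact h1.trans h3
    have : 0 ≤ 4 * (1 / ‖x - y‖ ^ 3) := by positivity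
    linarith
  · have h3 : 1 / ‖y‖ ≤ 2 := by
      rw [div_le_iff₀ hb]
      linarith
    have : |gradKer i (x - y)| * (1 / ‖y‖) ≤ (2 / ‖x - y‖ ^ 3) * 2 := by gcongr
    have : 0 ≤ 16 * (1 / ‖y‖) := by positivity
    have : (2 / ‖x - y‖ ^ 3) * 2 = 4 * (1 / ‖x - y‖ ^ 3) := by ring
    linarith

/-- The gradient of the Newtonian potential of a density bounded by `C / |y|` has oscillation
bounded by a multiple of `C` on an annulus. -/
lemma exists_gradKer_oscillation_bound (i : Fin 4) : ∃ A, 0 ≤ A ∧ ∀ (C : ℝ) (h : E4 → ℝ), 0 ≤ C →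
    Continuous h → HasCompactSupport h → (∀ y, y ≠ 0 → |h y| ≤ C * (1 / ‖y‖)) →
    ∀ x x' : E4, 1 ≤ ‖x‖ → ‖x‖ ≤ 4 → 1 ≤ ‖x'‖ → ‖x'‖ ≤ 4 →
    |(∫ y, gradKer i (x - y) * h y) - ∫ y, gradKer i (x' - y) * h y| ≤ A * C := by
  set g1 : E4 → ℝ := (Metric.ball (0 : E4) 9).indicator (fun y => 1 / ‖y‖ ^ 1) with hg1
  set g3 : E4 → ℝ := (Metric.ball (0 : E4) 13).indicator (fun y => 1 / ‖y‖ ^ 3) with hg3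
  have ig1 : Integrable g1 := integrable_indicator_ball (by norm_num) 9
  have ig3 : Integrable g3 := integrable_indicator_ball (by norm_num) 13
  have g1n : ∀ y, 0 ≤ g1 y := fun y => Set.indicator_nonneg (fun y _ => by positivity) y
  have g3n : ∀ y, 0 ≤ g3 y := fun y => Set.indicator_nonneg (fun y _ => by positivity) y
  set c : ℝ := 2050 * 8 * 16 * 32 with hcdef
  refine ⟨32 * (∫ y, g1 y) + (4 * (∫ y, g3 y) + 4 * ∫ y, g3 y) +
    c * ∫ y : E4, 1 / (1 + ‖y‖) ^ 5, ?_, ?_⟩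
  · have h1 : 0 ≤ ∫ y, g1 y := integral_nonneg g1n
    have h3 : 0 ≤ ∫ y, g3 y := integral_nonneg g3n
    have h5 : 0 ≤ ∫ y : E4, 1 / (1 + ‖y‖) ^ 5 := integral_nonneg fun y => by positivity
    positivity
  intro C h hC hh hcs hb x x' hx1 hx4 hx1' hx4'
  rw [← integral_sub (integrable_gradKer_mul i hh hcs x) (integrable_gradKer_mul i hh hcs x')]
  set W : E4 → ℝ := fun y => (32 * g1 y + (4 * g3 (x - y) + 4 * g3 (x' - y)) +
    c * (1 / (1 + ‖y‖) ^ 5)) * C with hW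
  have i1 : Integrable (fun y => 32 * g1 y) := ig1.const_mul _
  have i2 : Integrable (fun y => 4 * g3 (x - y)) := (ig3.comp_sub_left x).const_mul _
  have i3 : Integrable (fun y => 4 * g3 (x' - y)) := (ig3.comp_sub_left x').const_mul _
  have i4 : Integrable (fun y : E4 => c * (1 / (1 + ‖y‖) ^ 5)) :=
    integrable_one_add_norm_pow_five.const_mul _
  have i23 : Integrable (fun y => 4 * g3 (x - y) + 4 * g3 (x' - y)) := i2.add i3
  have i123 : Integrable (fun y => 32 * g1 y + (4 * g3 (x - y) + 4 * g3 (x' - y))) := i1.add i23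
  have hWi : Integrable W := (i123.add i4).mul_const C
  have hWint : ∫ y, W y = (32 * (∫ y, g1 y) + (4 * (∫ y, g3 y) + 4 * ∫ y, g3 y) +
      c * ∫ y : E4, 1 / (1 + ‖y‖) ^ 5) * C := by
    rw [hW, integral_mul_const, integral_add i123 i4, integral_add i1 i23,
      integral_add i2 i3, integral_const_mul, integral_const_mul, integral_const_mul,
      integral_const_mul, integral_sub_left_eq_self g3 volume x,
      integral_sub_left_eq_self g3 volume x']
  rw [← hWint, ← Real.norm_eq_abs]
  refine norm_integral_le_of_norm_le hWi ?_
  have hne : ∀ v : E4, ∀ᵐ y : E4, v - y ≠ 0 := fun v => by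
    simp [ae_iff, sub_eq_zero]
  filter_upwards [ae_ne_zero, hne x, hne x'] with y hy hxy hxy'
  have hy0 : 0 < ‖y‖ := norm_pos_iff.2 hy
  have hhy := hb y hy
  rw [← sub_mul, Real.norm_eq_abs, abs_mul]
  suffices H : |gradKer i (x - y) - gradKer i (x' - y)| * (1 / ‖y‖) ≤
      32 * g1 y + (4 * g3 (x - y) + 4 * g3 (x' - y)) + c * (1 / (1 + ‖y‖) ^ 5) by
    calc _ ≤ |gradKer i (x - y) - gradKer i (x' - y)| * (C * (1 / ‖y‖)) := by gcongr
      _ = |gradKer i (x - y) - gradKer i (x' - y)| * (1 / ‖y‖) * C := by ring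
      _ ≤ _ := mul_le_mul_of_nonneg_right H hC
  have n1 := g1n y
  have n3 := g3n (x - y)
  have n3' := g3n (x' - y)
  have n5 : 0 ≤ c * (1 / (1 + ‖y‖) ^ 5) := by positivity
  rcases le_total ‖y‖ 8 with h8 | h8
  · have e1 : g1 y = 1 / ‖y‖ := by
      rw [hg1, Set.indicator_of_mem (by simp; linarith), pow_one]
    have e3 : ∀ v : E4, ‖v‖ ≤ 4 → g3 (v - y) = 1 / ‖v - y‖ ^ 3 := fun v hv => by
      rw [hg3, Set.indicator_of_mem]
      have := norm_sub_le v y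
      simp only [Metric.mem_ball, dist_zero_right]
      linarith
    have k1 := gradKer_mul_near i hx1 hy hxy
    have k2 := gradKer_mul_near i hx1' hy hxy'
    rw [← e1, ← e3 x hx4] at k1
    rw [← e1, ← e3 x' hx4'] at k2
    rw [← e1]
    have : |gradKer i (x - y) - gradKer i (x' - y)| * g1 y ≤
        (|gradKer i (x - y)| + |gradKer i (x' - y)|) * g1 y := by
      gcongr
      exact abs_sub _ _
    rw [add_mul] at this
    linarith
  · have a1 := norm_sub_norm_le y x
    have a2 := norm_sub_le x y
    have a1' := norm_sub_norm_le y x'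
    have a2' := norm_sub_le x' y
    rw [norm_sub_rev] at a1 a1'
    have k := abs_gradKer_sub_le i (z := x - y) (w := x' - y) (s := ‖y‖ / 2) (by positivity)
      (by linarith) (by linarith) (by linarith) (by linarith)
    have d1 : ‖x - y - (x' - y)‖ ≤ 8 := by
      have := norm_sub_le x x'
      rw [sub_sub_sub_cancel_right]
      linarith
    have k2 : |gradKer i (x - y) - gradKer i (x' - y)| * (1 / ‖y‖) ≤ c * (1 / (2 * ‖y‖) ^ 5) := by
      calc _ ≤ 2050 * 8 / (‖y‖ / 2) ^ 4 * (1 / ‖y‖) := by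
            gcongr
            refine k.trans ?_
            gcongr
        _ = _ := by rw [hcdef]; field_simp; ring
    have k3 : c * (1 / (2 * ‖y‖) ^ 5) ≤ c * (1 / (1 + ‖y‖) ^ 5) := by
      gcongr
      linarith
    linarith

/-- Decay of the gradient of the Newtonian potential of a density concentrated on
`|y| ≲ 1/n` and `|y| ≈ n`. -/
lemma exists_gradKer_tail_bound (i : Fin 4) : ∃ A, 0 ≤ A ∧ ∀ (B : ℝ) (n : ℕ) (g : E4 → ℝ), 0 ≤ B →
    6 ≤ n → (∀ y, ‖y‖ ≤ 3 / n → |g y| ≤ B * n ^ 2) →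
    (∀ y, 2 * n ≤ ‖y‖ → |g y| ≤ B / n ^ 2) → (∀ y, 3 / n < ‖y‖ → ‖y‖ < 2 * n → g y = 0) →
    (∀ y, 3 * n < ‖y‖ → g y = 0) →
    ∀ x : E4, 1 ≤ ‖x‖ → ‖x‖ ≤ 4 → |∫ y, gradKer i (x - y) * g y| ≤ A * B / n := by
  set v : ℝ := volume.real (Metric.ball (0 : E4) 1) with hv
  have hv0 : 0 ≤ v := measureReal_nonneg
  refine ⟨(16 * 81 + 2 * 81) * v, by positivity, ?_⟩
  intro B n g hB hn h1 h2 h3 h4 x hx1 hx4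
  have hn6 : (6 : ℝ) ≤ n := by exact_mod_cast hn
  have hn0 : (0 : ℝ) < n := by linarith
  set s1 := Metric.closedBall (0 : E4) (3 / n)
  set s2 := Metric.closedBall (0 : E4) (3 * n)
  have m1 : MeasurableSet s1 := Metric.isClosed_closedBall.measurableSet
  have m2 : MeasurableSet s2 := Metric.isClosed_closedBall.measurableSet
  set W : E4 → ℝ := fun y => s1.indicator (fun _ => 16 * (B * n ^ 2)) y +
    s2.indicator (fun _ => 2 / n ^ 3 * (B / n ^ 2)) y
  have i1 : Integrable (s1.indicator (fun _ : E4 => 16 * (B * (n : ℝ) ^ 2))) :=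
    (integrable_indicator_iff m1).2 (integrableOn_const (isCompact_closedBall _ _).measure_lt_top.ne)
  have i2 : Integrable (s2.indicator (fun _ : E4 => 2 / (n : ℝ) ^ 3 * (B / (n : ℝ) ^ 2))) :=
    (integrable_indicator_iff m2).2 (integrableOn_const (isCompact_closedBall _ _).measure_lt_top.ne)
  have v1 : volume.real s1 = (3 / (n : ℝ)) ^ 4 * v := by
    simpa using Measure.addHaar_real_closedBall (volume : Measure E4) 0
      (by positivity : (0 : ℝ) ≤ 3 / n)
  have v2 : volume.real s2 = (3 * (n : ℝ)) ^ 4 * v := by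
    simpa using Measure.addHaar_real_closedBall (volume : Measure E4) 0
      (by positivity : (0 : ℝ) ≤ 3 * n)
  have hWint : ∫ y, W y = (3 / (n : ℝ)) ^ 4 * v * (16 * (B * n ^ 2)) +
      (3 * (n : ℝ)) ^ 4 * v * (2 / n ^ 3 * (B / n ^ 2)) := by
    rw [integral_add i1 i2, integral_indicator_const _ m1, integral_indicator_const _ m2, v1, v2]
    simp only [smul_eq_mul]
  have hle : ∫ y, W y ≤ (16 * 81 + 2 * 81) * v * B / n := by
    rw [hWint]
    have e1 : (3 / (n : ℝ)) ^ 4 * v * (16 * (B * n ^ 2)) = 16 * 81 * v * B / n * (1 / n) := by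
      field_simp; ring
    have e2 : (3 * (n : ℝ)) ^ 4 * v * (2 / n ^ 3 * (B / n ^ 2)) = 2 * 81 * v * B / n := by
      field_simp; ring
    have e3 : 1 / (n : ℝ) ≤ 1 := by
      rw [div_le_one hn0]; linarith
    have e4 : 16 * 81 * v * B / n * (1 / n) ≤ 16 * 81 * v * B / n * 1 := by gcongr
    rw [e1, e2]
    have : (16 * 81 + 2 * 81) * v * B / n = 16 * 81 * v * B / n * 1 + 2 * 81 * v * B / n := by ring
    linarith
  refine le_trans ?_ hle
  rw [← Real.norm_eq_abs]
  refine norm_integral_le_of_norm_le (i1.add i2) (Eventually.of_forall fun y => ?_)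
  have n1 : 0 ≤ s1.indicator (fun _ => 16 * (B * (n : ℝ) ^ 2)) y :=
    Set.indicator_nonneg (fun _ _ => by positivity) y
  have n2 : 0 ≤ s2.indicator (fun _ => 2 / (n : ℝ) ^ 3 * (B / (n : ℝ) ^ 2)) y :=
    Set.indicator_nonneg (fun _ _ => by positivity) y
  have ker : ∀ t : ℝ, 0 < t → t ≤ ‖x - y‖ → |gradKer i (x - y)| ≤ 2 / t ^ 3 := fun t ht htx => by
    refine (abs_gradKer_le i (norm_pos_iff.1 (ht.trans_le htx))).trans ?_
    gcongr
  rw [norm_mul, Real.norm_eq_abs, Real.norm_eq_abs]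
  change _ ≤ s1.indicator (fun _ => 16 * (B * (n : ℝ) ^ 2)) y +
    s2.indicator (fun _ => 2 / (n : ℝ) ^ 3 * (B / (n : ℝ) ^ 2)) y
  by_cases c1 : ‖y‖ ≤ 3 / n
  · have e : s1.indicator (fun _ => 16 * (B * (n : ℝ) ^ 2)) y = 16 * (B * (n : ℝ) ^ 2) :=
      Set.indicator_of_mem (by simpa [s1] using c1) _
    have : 3 / (n : ℝ) ≤ 1 / 2 := by
      rw [div_le_iff₀ hn0]; linarith
    have k := ker (1 / 2) (by norm_num) (by have := norm_sub_norm_le x y; linarith)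
    have k' : |gradKer i (x - y)| ≤ 16 := k.trans (by norm_num)
    have : |gradKer i (x - y)| * |g y| ≤ 16 * (B * (n : ℝ) ^ 2) := by
      gcongr
      exact h1 y c1
    linarith
  by_cases c2 : ‖y‖ < 2 * n
  · rw [h3 y (not_le.1 c1) c2]
    simp only [abs_zero, mul_zero]
    linarith
  by_cases c3 : 3 * n < ‖y‖
  · rw [h4 y c3]
    simp only [abs_zero, mul_zero]
    linarith
  have e : s2.indicator (fun _ => 2 / (n : ℝ) ^ 3 * (B / (n : ℝ) ^ 2)) y =
      2 / (n : ℝ) ^ 3 * (B / (n : ℝ) ^ 2) :=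
    Set.indicator_of_mem (by simpa [s2] using not_lt.1 c3) _
  have k := ker n hn0 (by
    have := norm_sub_norm_le y x
    rw [norm_sub_rev] at this
    linarith [not_lt.1 c2])
  have : |gradKer i (x - y)| * |g y| ≤ 2 / (n : ℝ) ^ 3 * (B / (n : ℝ) ^ 2) := by
    gcongr
    exact h2 y (not_lt.1 c2)
  linarith

/-- A smooth solution of the steady Navier-Stokes equations away from the origin whose velocity
components are bounded by `C / |x|`. -/
structure IsSol (C : ℝ) (u : Fin 4 → E4 → ℝ) (p : E4 → ℝ) : Prop where
  smooth_u : ∀ j, ContDiffOn ℝ ∞ (u j) {x | x ≠ 0}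
  smooth_p : ContDiffOn ℝ ∞ p {x | x ≠ 0}
  ns : ∀ x, x ≠ 0 → ∀ j,
    -(∑ i, pd i (pd i (u j)) x) + (∑ i, u i x * pd i (u j) x) + pd j p x = 0
  div : ∀ x, x ≠ 0 → ∑ i, pd i (u i) x = 0
  bound : ∀ x, x ≠ 0 → ∀ j, |u j x| ≤ C / ‖x‖

/-- Globally smooth fields solving the steady Navier-Stokes equations on `S`. -/
structure IsSolOn (S : Set E4) (U : Fin 4 → E4 → ℝ) (P : E4 → ℝ) : Prop where
  smooth_u : ∀ j, ContDiff ℝ ∞ (U j)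
  smooth_p : ContDiff ℝ ∞ P
  ns : ∀ x ∈ S, ∀ j,
    -(∑ i, pd i (pd i (U j)) x) + (∑ i, U i x * pd i (U j) x) + pd j P x = 0
  div : ∀ x ∈ S, ∑ i, pd i (U i) x = 0

lemma IsSolOn.mono {S T : Set E4} {U : Fin 4 → E4 → ℝ} {P : E4 → ℝ} (h : IsSolOn S U P)
    (hT : T ⊆ S) : IsSolOn T U P :=
  ⟨h.smooth_u, h.smooth_p, fun x hx => h.ns x (hT hx), fun x hx => h.div x (hT hx)⟩

/-- A bump function equal to `1` on `|x| ≤ 2` and to `0` on `|x| ≥ 3`. -/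
noncomputable def bump : ContDiffBump (0 : E4) := ⟨2, 3, by norm_num, by norm_num⟩

/-- A cutoff function equal to `0` on `|x| ≤ 2` and to `1` on `|x| ≥ 3`. -/
noncomputable def cut (x : E4) : ℝ := 1 - bump x

@[fun_prop]
lemma contDiff_cut : ContDiff ℝ ∞ cut := contDiff_const.sub bump.contDiff

lemma cut_nonneg (x : E4) : 0 ≤ cut x := sub_nonneg.2 bump.le_one

lemma cut_le_one (x : E4) : cut x ≤ 1 := sub_le_self 1 bump.nonneg

lemma cut_eq_zero {x : E4} (hx : ‖x‖ ≤ 2) : cut x = 0 := by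
  rw [cut, bump.one_of_mem_closedBall (by simpa [bump] using hx), sub_self]

lemma cut_eq_one {x : E4} (hx : 3 ≤ ‖x‖) : cut x = 1 := by
  rw [cut, bump.zero_of_le_dist (by simpa [bump] using hx), sub_zero]

lemma tsupport_pd_cut_subset (k : Fin 4) :
    tsupport (pd k cut) ⊆ {x | 2 ≤ ‖x‖ ∧ ‖x‖ ≤ 3} := by
  have hcl : IsClosed {x : E4 | 2 ≤ ‖x‖ ∧ ‖x‖ ≤ 3} :=
    (isClosed_le continuous_const continuous_norm).inter
      (isClosed_le continuous_norm continuous_const)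
  refine closure_minimal (fun x hx => ?_) hcl
  by_contra hc
  apply hx
  rcases not_and_or.1 hc with h | h
  · have : cut =ᶠ[𝓝 x] fun _ => 0 := by
      filter_upwards [(isOpen_lt continuous_norm continuous_const).mem_nhds (not_le.1 h)] with y hy
      exact cut_eq_zero (le_of_lt hy)
    rw [pd_congr this, pd_const]
  · have : cut =ᶠ[𝓝 x] fun _ => 1 := by
      filter_upwards [(isOpen_lt continuous_const continuous_norm).mem_nhds (not_le.1 h)] with y hy
      exact cut_eq_one (le_of_lt hy)
    rw [pd_congr this, pd_const]

lemma hasCompactSupport_pd_cut (k : Fin 4) : HasCompactSupport (pd k cut) :=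
  (isCompact_closedBall (0 : E4) 3).of_isClosed_subset (isClosed_tsupport _)
    ((tsupport_pd_cut_subset k).trans fun x hx => by simpa using hx.2)

lemma integral_divergence {F : Fin 4 → E4 → ℝ} (hF : ∀ k, ContDiff ℝ ∞ (F k))
    (hc : ∀ k, HasCompactSupport (F k)) : ∫ x, ∑ k, pd k (F k) x = 0 := by
  rw [integral_finsetSum _ fun k _ =>
    (contDiff_pd k (hF k)).continuous.integrable_of_hasCompactSupport (hasCompactSupport_pd k (hc k))]
  exact Finset.sum_eq_zero fun k _ => integral_pd_eq_zero k (hF k) (hc k)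

lemma exists_smooth_extension {f : E4 → ℝ} (hf : ContDiffOn ℝ ∞ f {x | x ≠ 0}) {r : ℝ}
    (hr : 0 < r) : ∃ F : E4 → ℝ, ContDiff ℝ ∞ F ∧ ∀ x, r < ‖x‖ → F x = f x := by
  refine ⟨fun x => cut ((3 / r) • x) * f x, contDiff_iff_contDiffAt.2 fun x => ?_, fun x hx => ?_⟩
  · by_cases hx : x = 0
    · have : (fun x => cut ((3 / r) • x) * f x) =ᶠ[𝓝 x] fun _ => 0 := by
        have h0 : ContinuousAt (fun y : E4 => ‖(3 / r) • y‖) x := by fun_prop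
        filter_upwards [h0.eventually_lt (continuousAt_const (y := (2 : ℝ)))
          (by simp [hx])] with y hy
        rw [cut_eq_zero hy.le, zero_mul]
      exact contDiffAt_const.congr_of_eventuallyEq this
    · refine ContDiffAt.mul ?_ (hf.contDiffAt (isOpen_ne.mem_nhds hx))
      exact (contDiff_cut.comp (contDiff_const_smul _)).contDiffAt
  · simp only
    rw [cut_eq_one, one_mul]
    rw [norm_smul, Real.norm_of_nonneg (by positivity), div_mul_eq_mul_div, le_div_iff₀ hr]
    linarith

lemma IsSol.exists_isSolOn {C : ℝ} {u : Fin 4 → E4 → ℝ} {p : E4 → ℝ} (h : IsSol C u p) {r : ℝ}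
    (hr : 0 < r) : ∃ U P, IsSolOn {x | r < ‖x‖} U P ∧ (∀ j x, r < ‖x‖ → U j x = u j x) ∧
      ∀ x, r < ‖x‖ → P x = p x := by
  choose U hU hUu using fun j => exists_smooth_extension (h.smooth_u j) hr
  obtain ⟨P, hP, hPp⟩ := exists_smooth_extension h.smooth_p hr
  have hS : IsOpen {x : E4 | r < ‖x‖} := isOpen_lt continuous_const continuous_norm
  have h1 : ∀ i j, ∀ x ∈ {x : E4 | r < ‖x‖}, pd i (U j) x = pd i (u j) x := fun i j =>
    pd_congr_on hS (hUu j)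
  have hne : ∀ x ∈ {x : E4 | r < ‖x‖}, x ≠ 0 := fun x hx => norm_pos_iff.1 (hr.trans hx)
  refine ⟨U, P, ⟨hU, hP, fun x hx j => ?_, fun x hx => ?_⟩, hUu, hPp⟩
  · rw [← h.ns x (hne x hx) j, pd_congr_on hS hPp x hx]
    simp only [hUu _ x hx, h1 _ _ x hx, pd_congr_on hS (h1 _ _) x hx]
  · rw [← h.div x (hne x hx)]
    simp only [h1 _ _ x hx]

/-- The local energy flux of `(U, P)` against a cutoff function. -/
noncomputable def fluxDensity (U : Fin 4 → E4 → ℝ) (P φ : E4 → ℝ) (x : E4) : ℝ :=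
  (1 / 2 * ∑ j, U j x ^ 2) * ∑ k, pd k (pd k φ) x +
    (1 / 2 * ∑ j, U j x ^ 2 + P x) * ∑ k, U k x * pd k φ x

lemma eq_zero_of_notMem_tsupport_pd {f : E4 → ℝ} (k : Fin 4) {x : E4} (hx : x ∉ tsupport f) :
    pd k f x = 0 :=
  image_eq_zero_of_notMem_tsupport fun h => hx (tsupport_pd_subset k f h)

/-- The local energy identity. -/
lemma IsSolOn.integral_energy {S : Set E4} {U : Fin 4 → E4 → ℝ} {P : E4 → ℝ}
    (h : IsSolOn S U P) {φ : E4 → ℝ} (hφ : ContDiff ℝ ∞ φ) (hc : HasCompactSupport φ)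
    (hS : tsupport φ ⊆ S) :
    ∫ x, φ x * ∑ i, ∑ j, pd i (U j) x ^ 2 = ∫ x, fluxDensity U P φ x := by
  have hU := h.smooth_u
  have hP := h.smooth_p
  set F : Fin 4 → E4 → ℝ := fun k x => φ x * (∑ j, U j x * pd k (U j) x) +
    ((-1 / 2 * ∑ j, U j x * U j x) * pd k φ x +
    φ x * ((-1 / 2 * (∑ j, U j x * U j x) - P x) * U k x)) with hFdef
  have hF : ∀ k, ContDiff ℝ ∞ (F k) := fun k => by fun_prop
  have hFc : ∀ k, HasCompactSupport (F k) := fun k =>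
    hc.mul_right.add ((hasCompactSupport_pd k hc).mul_left.add hc.mul_right)
  have key : ∀ x, ∑ k, pd k (F k) x =
      φ x * ∑ i, ∑ j, pd i (U j) x ^ 2 - fluxDensity U P φ x := by
    intro x
    by_cases hx : x ∈ S
    · have e1 : ∀ k, pd k (F k) x = pd k φ x * (∑ j, U j x * pd k (U j) x) +
          φ x * (∑ j, (pd k (U j) x * pd k (U j) x + U j x * pd k (pd k (U j)) x)) +
          ((- ∑ j, U j x * pd k (U j) x) * pd k φ x +
            (-1 / 2 * ∑ j, U j x * U j x) * pd k (pd k φ) x +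
          (pd k φ x * ((-1 / 2 * (∑ j, U j x * U j x) - P x) * U k x) +
            φ x * ((- (∑ j, U j x * pd k (U j) x) - pd k P x) * U k x +
              (-1 / 2 * (∑ j, U j x * U j x) - P x) * pd k (U k) x))) := by
        intro k
        simp (disch := fun_prop) only [hFdef, pd_add, pd_mul, pd_sub, pd_sum, pd_const]
        simp only [Fin.sum_univ_four]
        ring
      have ns := h.ns x hx
      have dv := h.div x hx
      simp only [e1, fluxDensity]
      simp only [Fin.sum_univ_four] at ns dv ⊢
      linear_combination (- φ x * U 0 x) * ns 0 + (- φ x * U 1 x) * ns 1 + (- φ x * U 2 x) * ns 2 +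
        (- φ x * U 3 x) * ns 3 - φ x * (1 / 2 * (U 0 x * U 0 x + U 1 x * U 1 x + U 2 x * U 2 x +
          U 3 x * U 3 x) + P x) * dv
    · have hx' : x ∉ tsupport φ := fun h => hx (hS h)
      have z0 : φ =ᶠ[𝓝 x] fun _ => 0 := notMem_tsupport_iff_eventuallyEq.1 hx'
      have z1 : ∀ k, pd k φ =ᶠ[𝓝 x] fun _ => 0 := fun k => by
        simpa using pd_congr_nhds (i := k) z0
      have z2 : ∀ k, pd k (pd k φ) x = 0 := fun k => by
        rw [pd_congr (z1 k), pd_const]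
      have z3 : ∀ k, pd k (F k) x = 0 := fun k => by
        have : F k =ᶠ[𝓝 x] fun _ => 0 := by
          filter_upwards [z0, z1 k] with y hy hy'
          simp [hFdef, hy, hy']
        rw [pd_congr this, pd_const]
      simp [z3, fluxDensity, z2, z0.eq_of_nhds, (z1 _).eq_of_nhds]
  have i1 : Integrable (fun x => φ x * ∑ i, ∑ j, pd i (U j) x ^ 2) :=
    Continuous.integrable_of_hasCompactSupport
      (ContDiff.continuous (𝕜 := ℝ) (n := ∞) (by fun_prop)) hc.mul_right
  have i2 : Integrable (fluxDensity U P φ) := by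
    refine Continuous.integrable_of_hasCompactSupport
      (ContDiff.continuous (𝕜 := ℝ) (n := ∞) (by unfold fluxDensity; fun_prop)) ?_
    refine HasCompactSupport.intro hc fun x hx => ?_
    have z1 : ∀ k, pd k φ x = 0 := fun k => eq_zero_of_notMem_tsupport_pd k hx
    have z2 : ∀ k, pd k (pd k φ) x = 0 := fun k =>
      eq_zero_of_notMem_tsupport_pd k fun h => hx (tsupport_pd_subset k φ h)
    simp [fluxDensity, z1, z2]
  have h0 := integral_divergence hF hFc
  simp only [key] at h0
  rw [integral_sub i1 i2] at h0
  linarith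

/-- Interior energy estimate for `Δ f = ∑ ∂ₘ gₘ`. -/
lemma integral_sq_mul_gradient_le {S : Set E4} {f : E4 → ℝ} {g : Fin 4 → E4 → ℝ} {χ : E4 → ℝ}
    {M C : ℝ} (hf : ContDiff ℝ ∞ f) (hg : ∀ m, ContDiff ℝ ∞ (g m)) (hχ : ContDiff ℝ ∞ χ)
    (hc : HasCompactSupport χ) (hS : tsupport χ ⊆ S)
    (hΔ : ∀ x ∈ S, ∑ k, pd k (pd k f) x = ∑ m, pd m (g m) x)
    (hM : ∀ x ∈ S, |f x| ≤ M) (hC : ∀ x ∈ S, ∀ m, |g m x| ≤ C) :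
    ∫ x, χ x ^ 2 * ∑ k, pd k f x ^ 2 ≤
      2 * ∫ x, ∑ k, ((4 * M ^ 2 + C ^ 2) * pd k χ x ^ 2 + (M ^ 2 + C ^ 2) * χ x ^ 2) := by
  set F : Fin 4 → E4 → ℝ := fun k x => χ x * (χ x * (f x * (pd k f x - g k x))) with hFdef
  have hF : ∀ k, ContDiff ℝ ∞ (F k) := fun k => by fun_prop
  have hFc : ∀ k, HasCompactSupport (F k) := fun k => hc.mul_right
  have e1 : ∀ k x, pd k (F k) x = 2 * χ x * pd k χ x * f x * (pd k f x - g k x) +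
      χ x ^ 2 * pd k f x * (pd k f x - g k x) +
      χ x ^ 2 * f x * (pd k (pd k f) x - pd k (g k) x) := by
    intro k x
    simp (disch := fun_prop) only [hFdef, pd_mul, pd_sub]
    ring
  have key : ∀ x, χ x ^ 2 * ∑ k, pd k f x ^ 2 ≤ 2 * (∑ k, pd k (F k) x) +
      2 * ∑ k, ((4 * M ^ 2 + C ^ 2) * pd k χ x ^ 2 + (M ^ 2 + C ^ 2) * χ x ^ 2) := by
    intro x
    by_cases hx : x ∈ tsupport χ
    · have hxS := hS hx
      have h0 : ∑ k, χ x ^ 2 * f x * (pd k (pd k f) x - pd k (g k) x) = 0 := by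
        rw [← Finset.mul_sum, Finset.sum_sub_distrib, hΔ x hxS, sub_self, mul_zero]
      have hsum : ∑ k, pd k (F k) x = ∑ k, (2 * χ x * pd k χ x * f x * (pd k f x - g k x) +
          χ x ^ 2 * pd k f x * (pd k f x - g k x)) := by
        simp only [e1]
        rw [Finset.sum_add_distrib, h0, add_zero]
      rw [hsum, Finset.mul_sum, Finset.mul_sum, Finset.mul_sum, ← Finset.sum_add_distrib]
      refine Finset.sum_le_sum fun k _ => ?_
      have hf2 : f x ^ 2 ≤ M ^ 2 := sq_le_sq' (abs_le.1 (hM x hxS)).1 (abs_le.1 (hM x hxS)).2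
      have hg2 : g k x ^ 2 ≤ C ^ 2 := sq_le_sq' (abs_le.1 (hC x hxS k)).1 (abs_le.1 (hC x hxS k)).2
      have a1 : 0 ≤ (M ^ 2 - f x ^ 2) * pd k χ x ^ 2 := mul_nonneg (by linarith) (sq_nonneg _)
      have a2 : 0 ≤ (M ^ 2 - f x ^ 2) * χ x ^ 2 := mul_nonneg (by linarith) (sq_nonneg _)
      have a3 : 0 ≤ (C ^ 2 - g k x ^ 2) * pd k χ x ^ 2 := mul_nonneg (by linarith) (sq_nonneg _)
      have a4 : 0 ≤ (C ^ 2 - g k x ^ 2) * χ x ^ 2 := mul_nonneg (by linarith) (sq_nonneg _)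
      have b1 := sq_nonneg (χ x * pd k f x / 2 + 2 * (f x * pd k χ x))
      have b2 := sq_nonneg (χ x * pd k f x / 2 - χ x * g k x)
      have b3 := sq_nonneg (χ x * f x - pd k χ x * g k x)
      linarith
    · have h1 : χ x = 0 := image_eq_zero_of_notMem_tsupport hx
      have h2 : ∀ k, pd k χ x = 0 := fun k => eq_zero_of_notMem_tsupport_pd k hx
      simp [e1, h1, h2]
  have i1 : Integrable (fun x => χ x ^ 2 * ∑ k, pd k f x ^ 2) :=
    Continuous.integrable_of_hasCompactSupport
      (ContDiff.continuous (𝕜 := ℝ) (n := ∞) (by fun_prop))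
      (HasCompactSupport.intro hc fun x hx => by simp [image_eq_zero_of_notMem_tsupport hx])
  have i2 : Integrable (fun x => ∑ k, pd k (F k) x) := integrable_finsetSum _ fun k _ =>
    (contDiff_pd k (hF k)).continuous.integrable_of_hasCompactSupport (hasCompactSupport_pd k (hFc k))
  have i3 : Integrable (fun x =>
      ∑ k, ((4 * M ^ 2 + C ^ 2) * pd k χ x ^ 2 + (M ^ 2 + C ^ 2) * χ x ^ 2)) :=
    Continuous.integrable_of_hasCompactSupport
      (ContDiff.continuous (𝕜 := ℝ) (n := ∞) (by fun_prop))
      (HasCompactSupport.intro hc fun x hx => by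
        simp [image_eq_zero_of_notMem_tsupport hx, eq_zero_of_notMem_tsupport_pd _ hx])
  have h := integral_mono i1 ((i2.const_mul 2).add (i3.const_mul 2)) key
  have hle : ∫ x, χ x ^ 2 * ∑ k, pd k f x ^ 2 ≤ ∫ x, (2 * (∑ k, pd k (F k) x) +
      2 * ∑ k, ((4 * M ^ 2 + C ^ 2) * pd k χ x ^ 2 + (M ^ 2 + C ^ 2) * χ x ^ 2)) := h
  rwa [integral_add (i2.const_mul 2) (i3.const_mul 2), integral_const_mul, integral_const_mul,
    integral_divergence hF hFc, mul_zero, zero_add] at hle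

/-- The weak form of the steady Navier-Stokes equations. -/
lemma IsSolOn.integral_weak {S : Set E4} {U : Fin 4 → E4 → ℝ} {P : E4 → ℝ}
    (h : IsSolOn S U P) {w : Fin 4 → E4 → ℝ} (hw : ∀ i, ContDiff ℝ ∞ (w i))
    (hc : ∀ i, HasCompactSupport (w i)) (hS : ∀ i, tsupport (w i) ⊆ S) :
    ∫ x, (P x * ∑ i, pd i (w i) x + ∑ i, U i x * ∑ k, pd k (pd k (w i)) x +
      ∑ k, ∑ i, U k x * U i x * pd k (w i) x) = 0 := by
  have hU := h.smooth_u
  have hP := h.smooth_p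
  set F : Fin 4 → E4 → ℝ := fun k x => P x * w k x + ∑ i, (U i x * pd k (w i) x -
    pd k (U i) x * w i x + U k x * U i x * w i x) with hFdef
  have hF : ∀ k, ContDiff ℝ ∞ (F k) := fun k => by fun_prop
  have hz : ∀ x, (∀ i, x ∉ tsupport (w i)) → ∀ i, w i x = 0 := fun x hx i =>
    image_eq_zero_of_notMem_tsupport (hx i)
  have hFc : ∀ k, HasCompactSupport (F k) := fun k => by
    refine HasCompactSupport.intro (isCompact_iUnion hc) fun x hx => ?_
    have hx' : ∀ i, x ∉ tsupport (w i) := fun i hi => hx (Set.mem_iUnion.2 ⟨i, hi⟩)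
    simp [hFdef, hz x hx', eq_zero_of_notMem_tsupport_pd _ (hx' _)]
  rw [← integral_divergence hF hFc]
  congr 1
  ext x
  have e1 : ∀ k, pd k (F k) x = pd k P x * w k x + P x * pd k (w k) x +
      ∑ i, (U i x * pd k (pd k (w i)) x - pd k (pd k (U i)) x * w i x +
        (pd k (U k) x * U i x + U k x * pd k (U i) x) * w i x +
        U k x * U i x * pd k (w i) x) := by
    intro k
    simp (disch := fun_prop) only [hFdef, pd_add, pd_mul, pd_sub, pd_sum]
    simp only [Fin.sum_univ_four]
    ring
  simp only [e1]
  by_cases hx : x ∈ S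
  · have ns := h.ns x hx
    have dv := h.div x hx
    simp only [Fin.sum_univ_four] at ns dv ⊢
    linear_combination (- w 0 x) * ns 0 + (- w 1 x) * ns 1 + (- w 2 x) * ns 2 +
      (- w 3 x) * ns 3 - (U 0 x * w 0 x + U 1 x * w 1 x + U 2 x * w 2 x + U 3 x * w 3 x) * dv
  · have hx' : ∀ i, w i x = 0 := fun i => image_eq_zero_of_notMem_tsupport fun h => hx (hS i h)
    simp only [hx', Fin.sum_univ_four]
    ring

/-- Integration by parts for the antisymmetric part of the velocity gradient. -/
lemma IsSolOn.integral_curl {S : Set E4} {U : Fin 4 → E4 → ℝ} {P : E4 → ℝ}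
    (h : IsSolOn S U P) {v : Fin 4 → E4 → ℝ} (hv : ∀ i, ContDiff ℝ ∞ (v i))
    (hc : ∀ i, HasCompactSupport (v i)) (hS : ∀ i, tsupport (v i) ⊆ S) :
    ∫ x, (∑ i, ∑ j, U i x * (pd i (U j) x - pd j (U i) x) * v j x +
      (∑ i, ∑ j, U i x * U j x * pd i (v j) x -
        (1 / 2 * ∑ i, U i x * U i x) * ∑ j, pd j (v j) x)) = 0 := by
  have hU := h.smooth_u
  set F : Fin 4 → E4 → ℝ := fun k x => (∑ j, U k x * U j x * v j x) +
    (-1 / 2 * ∑ i, U i x * U i x) * v k x with hFdef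
  have hF : ∀ k, ContDiff ℝ ∞ (F k) := fun k => by fun_prop
  have hFc : ∀ k, HasCompactSupport (F k) := fun k => by
    refine HasCompactSupport.intro (isCompact_iUnion hc) fun x hx => ?_
    have hx' : ∀ i, v i x = 0 := fun i =>
      image_eq_zero_of_notMem_tsupport fun hi => hx (Set.mem_iUnion.2 ⟨i, hi⟩)
    simp [hFdef, hx']
  rw [← integral_divergence hF hFc]
  congr 1
  ext x
  have e1 : ∀ k, pd k (F k) x = (∑ j, ((pd k (U k) x * U j x + U k x * pd k (U j) x) * v j x +
      U k x * U j x * pd k (v j) x)) + (- (∑ i, U i x * pd k (U i) x) * v k x +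
      (-1 / 2 * ∑ i, U i x * U i x) * pd k (v k) x) := by
    intro k
    simp (disch := fun_prop) only [hFdef, pd_add, pd_mul, pd_sum, pd_const]
    simp only [Fin.sum_univ_four]
    ring
  simp only [e1]
  by_cases hx : x ∈ S
  · have dv := h.div x hx
    simp only [Fin.sum_univ_four] at dv ⊢
    linear_combination (-(U 0 x * v 0 x + U 1 x * v 1 x + U 2 x * v 2 x + U 3 x * v 3 x)) * dv
  · have hx' : ∀ i, v i x = 0 := fun i => image_eq_zero_of_notMem_tsupport fun h => hx (hS i h)
    simp only [hx', Fin.sum_univ_four]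
    ring

/-- The open annulus `1 < |x| < 4`. -/
def annulus : Set E4 := {x | 1 < ‖x‖ ∧ ‖x‖ < 4}

lemma isOpen_annulus : IsOpen annulus :=
  (isOpen_lt continuous_const continuous_norm).inter (isOpen_lt continuous_norm continuous_const)

lemma tsupport_pd_cut_subset_annulus (k : Fin 4) : tsupport (pd k cut) ⊆ annulus :=
  (tsupport_pd_cut_subset k).trans fun x hx => ⟨by linarith [hx.1], by linarith [hx.2]⟩

lemma exists_annulus_cutoff : ∃ χ : E4 → ℝ, ContDiff ℝ ∞ χ ∧ HasCompactSupport χ ∧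
    tsupport χ ⊆ annulus ∧ ∀ x, 2 ≤ ‖x‖ → ‖x‖ ≤ 3 → χ x = 1 := by
  let b : ContDiffBump (0 : E4) := ⟨3, 7 / 2, by norm_num, by norm_num⟩
  have hcl : IsClosed {x : E4 | 4 / 3 ≤ ‖x‖ ∧ ‖x‖ ≤ 7 / 2} :=
    (isClosed_le continuous_const continuous_norm).inter
      (isClosed_le continuous_norm continuous_const)
  have hn : ∀ x : E4, ‖(3 / 2 : ℝ) • x‖ = 3 / 2 * ‖x‖ := fun x => by
    rw [norm_smul]; norm_num
  have hsub : tsupport (fun x => cut ((3 / 2 : ℝ) • x) * b x) ⊆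
      {x : E4 | 4 / 3 ≤ ‖x‖ ∧ ‖x‖ ≤ 7 / 2} := by
    refine closure_minimal (fun x hx => ?_) hcl
    by_contra hc
    apply hx
    rcases not_and_or.1 hc with h | h
    · simp only
      rw [cut_eq_zero (by rw [hn]; linarith [not_le.1 h]), zero_mul]
    · simp only
      rw [b.zero_of_le_dist (by simpa [b] using (not_le.1 h).le), mul_zero]
  refine ⟨fun x => cut ((3 / 2 : ℝ) • x) * b x,
    (contDiff_cut.comp (contDiff_const_smul _)).mul b.contDiff, b.hasCompactSupport.mul_left,
    hsub.trans fun x hx => ⟨by linarith [hx.1], by linarith [hx.2]⟩, fun x h2 h3 => ?_⟩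
  simp only
  rw [cut_eq_one (by rw [hn]; linarith), b.one_of_mem_closedBall (by simpa [b] using h3), mul_one]

/-- The bounded remainder in the pairing of the pressure with a curl-type test field. -/
noncomputable def remainder (U v : Fin 4 → E4 → ℝ) (ψ : Fin 4 → Fin 4 → E4 → ℝ) (x : E4) : ℝ :=
  (∑ i, ∑ j, U i x * U j x * pd i (v j) x) -
    (1 / 2 * ∑ i, U i x * U i x) * (∑ j, pd j (v j) x) -
    (∑ i, ∑ j, ∑ k, U i x * (2 * pd k (ψ i j) x * pd k (v j) x + ψ i j x * pd k (pd k (v j)) x)) -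
    ∑ k, ∑ i, ∑ j, U k x * U i x * (pd k (ψ i j) x * v j x + ψ i j x * pd k (v j) x)

lemma sum_antisymm_mul_symm {a b : Fin 4 → Fin 4 → ℝ} (ha : ∀ i j, a i j = -a j i)
    (hb : ∀ i j, b i j = b j i) : ∑ i, ∑ j, a i j * b i j = 0 := by
  have h : ∑ i, ∑ j, a i j * b i j = - ∑ i, ∑ j, a i j * b i j := by
    conv_lhs => rw [Finset.sum_comm]
    simp only [← Finset.sum_neg_distrib]
    refine Finset.sum_congr rfl fun i _ => Finset.sum_congr rfl fun j _ => ?_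
    rw [ha j i, hb j i, neg_mul]
  linarith

lemma continuous_of_contDiff {f : E4 → ℝ} (hf : ContDiff ℝ ∞ f) : Continuous f := hf.continuous

lemma IsSolOn.integral_pressure {S : Set E4} {U : Fin 4 → E4 → ℝ} {P : E4 → ℝ}
    (h : IsSolOn S U P) {v : Fin 4 → E4 → ℝ} (hv : ∀ i, ContDiff ℝ ∞ (v i))
    (hc : ∀ i, HasCompactSupport (v i)) (hS : ∀ i, tsupport (v i) ⊆ S)
    (hsymm : ∀ i j, pd i (v j) = pd j (v i))
    {ψ : Fin 4 → Fin 4 → E4 → ℝ} (hψ : ∀ i j, ContDiff ℝ ∞ (ψ i j))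
    (hanti : ∀ i j x, ψ i j x = - ψ j i x)
    (hΔ : ∀ i j, ∀ x ∈ S, ∑ k, pd k (pd k (ψ i j)) x = pd i (U j) x - pd j (U i) x) :
    ∫ x, P x * ∑ j, (∑ i, pd i (ψ i j) x) * v j x = ∫ x, remainder U v ψ x := by
  have hU := h.smooth_u
  have hP := h.smooth_p
  set w : Fin 4 → E4 → ℝ := fun i x => ∑ j, ψ i j x * v j x with hwdef
  have hw : ∀ i, ContDiff ℝ ∞ (w i) := fun i => by fun_prop
  have hcl : IsClosed (⋃ j, tsupport (v j)) := isClosed_iUnion_of_finite fun j => isClosed_tsupport _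
  have hwt : ∀ i, tsupport (w i) ⊆ ⋃ j, tsupport (v j) := fun i => by
    refine closure_minimal (fun x hx => ?_) hcl
    by_contra hx'
    refine hx (Finset.sum_eq_zero fun j _ => ?_)
    rw [image_eq_zero_of_notMem_tsupport fun h => hx' (Set.mem_iUnion.2 ⟨j, h⟩), mul_zero]
  have hwc : ∀ i, HasCompactSupport (w i) := fun i =>
    (isCompact_iUnion hc).of_isClosed_subset (isClosed_tsupport _) (hwt i)
  have hwS : ∀ i, tsupport (w i) ⊆ S := fun i => (hwt i).trans (Set.iUnion_subset hS)
  have e1 : ∀ k i, pd k (w i) = fun x => ∑ j, (pd k (ψ i j) x * v j x + ψ i j x * pd k (v j) x) := by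
    intro k i
    simp (disch := fun_prop) only [hwdef, pd_mul, pd_sum]
  have e2 : ∀ i x, ∑ k, pd k (pd k (w i)) x = ∑ j, ((∑ k, pd k (pd k (ψ i j)) x) * v j x +
      ∑ k, (2 * pd k (ψ i j) x * pd k (v j) x + ψ i j x * pd k (pd k (v j)) x)) := by
    intro i x
    simp (disch := fun_prop) only [e1, pd_mul, pd_add, pd_sum]
    rw [Finset.sum_comm]
    refine Finset.sum_congr rfl fun j _ => ?_
    rw [Finset.sum_mul, ← Finset.sum_add_distrib]
    refine Finset.sum_congr rfl fun k _ => ?_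
    ring
  have h1 := h.integral_weak hw hwc hwS
  have h2 := h.integral_curl hv hc hS
  have hz : ∀ x, x ∉ (⋃ j, tsupport (v j)) → (∀ j, v j x = 0) ∧ (∀ i j, pd i (v j) x = 0) ∧
      ∀ k i j, pd k (pd i (v j)) x = 0 := fun x hx => by
    have hx' : ∀ j, x ∉ tsupport (v j) := fun j hj => hx (Set.mem_iUnion.2 ⟨j, hj⟩)
    exact ⟨fun j => image_eq_zero_of_notMem_tsupport (hx' j),
      fun i j => eq_zero_of_notMem_tsupport_pd i (hx' j),
      fun k i j => eq_zero_of_notMem_tsupport_pd k fun h => hx' j (tsupport_pd_subset i _ h)⟩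
  have pw : ∀ x, P x * ∑ j, (∑ i, pd i (ψ i j) x) * v j x - remainder U v ψ x =
      (P x * ∑ i, pd i (w i) x + ∑ i, U i x * ∑ k, pd k (pd k (w i)) x +
      ∑ k, ∑ i, U k x * U i x * pd k (w i) x) -
      (∑ i, ∑ j, U i x * (pd i (U j) x - pd j (U i) x) * v j x +
      (∑ i, ∑ j, U i x * U j x * pd i (v j) x -
        (1 / 2 * ∑ i, U i x * U i x) * ∑ j, pd j (v j) x)) := by
    intro x
    have a1 : ∑ i, pd i (w i) x = ∑ j, (∑ i, pd i (ψ i j) x) * v j x := by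
      have hz := sum_antisymm_mul_symm (a := fun i j => ψ i j x) (b := fun i j => pd i (v j) x)
        (fun i j => hanti i j x) (fun i j => by rw [hsymm i j])
      simp only [e1, Finset.sum_add_distrib, hz, add_zero, Finset.sum_mul]
      exact Finset.sum_comm
    have a2 : ∑ i, U i x * ∑ k, pd k (pd k (w i)) x =
        ∑ i, ∑ j, U i x * (pd i (U j) x - pd j (U i) x) * v j x +
        ∑ i, ∑ j, ∑ k, U i x *
          (2 * pd k (ψ i j) x * pd k (v j) x + ψ i j x * pd k (pd k (v j)) x) := by
      rw [← Finset.sum_add_distrib]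
      refine Finset.sum_congr rfl fun i _ => ?_
      rw [e2, Finset.mul_sum, ← Finset.sum_add_distrib]
      refine Finset.sum_congr rfl fun j _ => ?_
      rw [mul_add, Finset.mul_sum]
      congr 1
      by_cases hx : x ∈ S
      · rw [hΔ i j x hx]; ring
      · rw [image_eq_zero_of_notMem_tsupport fun h => hx (hS j h)]; simp
    have a3 : ∑ k, ∑ i, U k x * U i x * pd k (w i) x =
        ∑ k, ∑ i, ∑ j, U k x * U i x * (pd k (ψ i j) x * v j x + ψ i j x * pd k (v j) x) := by
      simp only [e1, Finset.mul_sum]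
    rw [a1, a2, a3, remainder]
    ring
  have i1 : Integrable (fun x => P x * ∑ j, (∑ i, pd i (ψ i j) x) * v j x) :=
    Continuous.integrable_of_hasCompactSupport (continuous_of_contDiff (by fun_prop))
      (HasCompactSupport.intro (isCompact_iUnion hc) fun x hx => by simp [(hz x hx).1])
  have i2 : Integrable (remainder U v ψ) :=
    Continuous.integrable_of_hasCompactSupport
      (continuous_of_contDiff (by unfold remainder; fun_prop))
      (HasCompactSupport.intro (isCompact_iUnion hc) fun x hx => by simp [remainder, hz x hx])
  have i3 : Integrable (fun x => P x * ∑ i, pd i (w i) x + ∑ i, U i x * ∑ k, pd k (pd k (w i)) x +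
      ∑ k, ∑ i, U k x * U i x * pd k (w i) x) :=
    Continuous.integrable_of_hasCompactSupport (continuous_of_contDiff (by fun_prop))
      (HasCompactSupport.intro (isCompact_iUnion hc) fun x hx => by
        simp only [e2]
        simp [e1, hz x hx])
  have i4 : Integrable (fun x => ∑ i, ∑ j, U i x * (pd i (U j) x - pd j (U i) x) * v j x +
      (∑ i, ∑ j, U i x * U j x * pd i (v j) x -
        (1 / 2 * ∑ i, U i x * U i x) * ∑ j, pd j (v j) x)) :=
    Continuous.integrable_of_hasCompactSupport (continuous_of_contDiff (by fun_prop))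
      (HasCompactSupport.intro (isCompact_iUnion hc) fun x hx => by simp [hz x hx])
  have := integral_congr_ae (μ := volume) (Eventually.of_forall pw)
  rw [integral_sub i1 i2, integral_sub i3 i4, h1, h2, sub_zero] at this
  linarith

lemma abs_sum_sum_le {a : Fin 4 → Fin 4 → ℝ} {b : ℝ} (h : ∀ i j, |a i j| ≤ b) :
    |∑ i, ∑ j, a i j| ≤ 16 * b := by
  refine (Finset.abs_sum_le_sum_abs _ _).trans ?_
  refine (Finset.sum_le_sum fun i _ => (Finset.abs_sum_le_sum_abs _ _).trans
    (Finset.sum_le_sum fun j _ => h i j)).trans_eq ?_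
  simp
  ring

lemma abs_sum_sum_sum_le {a b : Fin 4 → Fin 4 → Fin 4 → ℝ} (h : ∀ i j k, |a i j k| ≤ b i j k) :
    |∑ i, ∑ j, ∑ k, a i j k| ≤ ∑ i, ∑ j, ∑ k, b i j k :=
  (Finset.abs_sum_le_sum_abs _ _).trans (Finset.sum_le_sum fun i _ =>
    (Finset.abs_sum_le_sum_abs _ _).trans (Finset.sum_le_sum fun j _ =>
    (Finset.abs_sum_le_sum_abs _ _).trans (Finset.sum_le_sum fun k _ => h i j k)))

lemma abs_remainder_le {U v : Fin 4 → E4 → ℝ} {ψ : Fin 4 → Fin 4 → E4 → ℝ} {x : E4} {C M D : ℝ}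
    (hC : 0 ≤ C) (hD : 0 ≤ D) (hM : 0 ≤ M)
    (hU : ∀ i, |U i x| ≤ C) (hψ : ∀ i j, |ψ i j x| ≤ M) (hv0 : ∀ j, |v j x| ≤ D)
    (hv1 : ∀ i j, |pd i (v j) x| ≤ D) (hv2 : ∀ k j, |pd k (pd k (v j)) x| ≤ D) :
    |remainder U v ψ x| ≤ (48 * (C * C * D) + C * (2 + M) * D + C * C * (1 + M) * D) *
      ∑ i, ∑ j, ∑ k, (1 + pd k (ψ i j) x ^ 2) := by
  set T := ∑ i, ∑ j, ∑ k, (1 + pd k (ψ i j) x ^ 2) with hT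
  have hT1 : 1 ≤ T := by
    have h0 : 0 ≤ ∑ i, ∑ j, ∑ k, pd k (ψ i j) x ^ 2 := by positivity
    have : T = 64 + ∑ i, ∑ j, ∑ k, pd k (ψ i j) x ^ 2 := by
      simp only [hT, Finset.sum_add_distrib]
      norm_num
    linarith
  have hd : ∀ i j k, |pd k (ψ i j) x| ≤ 1 + pd k (ψ i j) x ^ 2 := fun i j k =>
    abs_le.2 ⟨by nlinarith, by nlinarith⟩
  have b1 : |∑ i, ∑ j, U i x * U j x * pd i (v j) x| ≤ 16 * (C * C * D) :=
    abs_sum_sum_le fun i j => by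
      rw [abs_mul, abs_mul]
      gcongr
      exacts [hU i, hU j, hv1 i j]
  have b2 : |(1 / 2 * ∑ i, U i x * U i x) * ∑ j, pd j (v j) x| ≤ 16 * (C * C * D) := by
    have : (1 / 2 * ∑ i, U i x * U i x) * ∑ j, pd j (v j) x =
        ∑ i, ∑ j, 1 / 2 * (U i x * U i x * pd j (v j) x) := by
      rw [mul_assoc, Finset.sum_mul_sum, Finset.mul_sum]
      simp only [Finset.mul_sum]
    rw [this]
    refine abs_sum_sum_le fun i j => ?_
    rw [abs_mul, abs_mul, abs_mul]
    have : |U i x| * |U i x| * |pd j (v j) x| ≤ C * C * D := by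
      gcongr
      exacts [hU i, hU i, hv1 j j]
    have h0 : 0 ≤ |U i x| * |U i x| * |pd j (v j) x| := by positivity
    rw [abs_of_pos (by norm_num : (0 : ℝ) < 1 / 2)]
    linarith
  have b3 : |∑ i, ∑ j, ∑ k, U i x *
      (2 * pd k (ψ i j) x * pd k (v j) x + ψ i j x * pd k (pd k (v j)) x)| ≤
      C * (2 + M) * D * T := by
    simp only [hT, Finset.mul_sum]
    refine abs_sum_sum_sum_le fun i j k => ?_
    have h1 : (1 : ℝ) ≤ 1 + pd k (ψ i j) x ^ 2 := by nlinarith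
    calc _ ≤ |U i x| * (2 * |pd k (ψ i j) x| * |pd k (v j) x| +
          |ψ i j x| * |pd k (pd k (v j)) x|) := by
          rw [abs_mul]
          gcongr
          refine (abs_add_le _ _).trans_eq ?_
          simp only [abs_mul, abs_two]
      _ ≤ C * (2 * (1 + pd k (ψ i j) x ^ 2) * D + M * D * (1 + pd k (ψ i j) x ^ 2)) := by
          have q : |ψ i j x| * |pd k (pd k (v j)) x| ≤ M * D * 1 := by
            rw [mul_one]
            exact mul_le_mul (hψ i j) (hv2 k j) (abs_nonneg _) hM
          have q' : M * D * 1 ≤ M * D * (1 + pd k (ψ i j) x ^ 2) := by gcongr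
          exact mul_le_mul (hU i) (add_le_add (by gcongr; exacts [hd i j k, hv1 k j])
            (q.trans q')) (by positivity) hC
      _ = _ := by ring
  have b4 : |∑ k, ∑ i, ∑ j, U k x * U i x *
      (pd k (ψ i j) x * v j x + ψ i j x * pd k (v j) x)| ≤ C * C * (1 + M) * D * T := by
    have hT' : T = ∑ k, ∑ i, ∑ j, (1 + pd k (ψ i j) x ^ 2) := by
      rw [hT]
      conv_rhs => rw [Finset.sum_comm]
      exact Finset.sum_congr rfl fun i _ => Finset.sum_comm
    rw [hT']
    simp only [Finset.mul_sum]
    refine abs_sum_sum_sum_le fun k i j => ?_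
    have h1 : (1 : ℝ) ≤ 1 + pd k (ψ i j) x ^ 2 := by nlinarith
    calc _ ≤ |U k x| * |U i x| * (|pd k (ψ i j) x| * |v j x| + |ψ i j x| * |pd k (v j) x|) := by
          rw [abs_mul, abs_mul]
          gcongr
          refine (abs_add_le _ _).trans_eq ?_
          simp only [abs_mul]
      _ ≤ C * C * ((1 + pd k (ψ i j) x ^ 2) * D + M * D * (1 + pd k (ψ i j) x ^ 2)) := by
          have q : |ψ i j x| * |pd k (v j) x| ≤ M * D * 1 := by
            rw [mul_one]
            exact mul_le_mul (hψ i j) (hv1 k j) (abs_nonneg _) hM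
          have q' : M * D * 1 ≤ M * D * (1 + pd k (ψ i j) x ^ 2) := by gcongr
          exact mul_le_mul (mul_le_mul (hU k) (hU i) (abs_nonneg _) hC)
            (add_le_add (by gcongr; exacts [hd i j k, hv0 j]) (q.trans q'))
            (by positivity) (by positivity)
      _ = _ := by ring
  have b5 : C * C * D ≤ C * C * D * T := le_mul_of_one_le_right (by positivity) hT1
  have hCCD : 0 ≤ C * C * D * T := by positivity
  rw [remainder]
  refine (abs_sub _ _).trans ?_
  refine (add_le_add ((abs_sub _ _).trans (add_le_add ((abs_sub _ _).trans
    (add_le_add b1 b2)) b3)) b4).trans ?_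
  rw [add_mul, add_mul]
  linarith

lemma exists_uniform_bound {ι : Type*} [Fintype ι] {f : ι → E4 → ℝ} (hf : ∀ i, Continuous (f i))
    (hc : ∀ i, HasCompactSupport (f i)) : ∃ D, 0 ≤ D ∧ ∀ i x, |f i x| ≤ D := by
  choose b hb using fun i => (hc i).exists_bound_of_continuous (hf i)
  have hb0 : ∀ i, 0 ≤ b i := fun i => (norm_nonneg _).trans (hb i 0)
  exact ⟨∑ i, b i, Finset.sum_nonneg fun i _ => hb0 i, fun i x =>
    (hb i x).trans (Finset.single_le_sum (fun i _ => hb0 i) (Finset.mem_univ i))⟩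

lemma exists_pressure_bound {C M : ℝ} (hC : 0 ≤ C) (hM : 0 ≤ M) : ∃ K, ∀ (U : Fin 4 → E4 → ℝ)
    (P : E4 → ℝ) (ε : ℝ) (ψ : Fin 4 → Fin 4 → E4 → ℝ), IsSolOn annulus U P →
    (∀ x ∈ annulus, ∀ j, |U j x| ≤ C) → (∀ i j, ContDiff ℝ ∞ (ψ i j)) →
    (∀ i j x, ψ i j x = - ψ j i x) →
    (∀ i j, ∀ x ∈ annulus, ∑ k, pd k (pd k (ψ i j)) x = pd i (U j) x - pd j (U i) x) →
    (∀ i j, ∀ x ∈ annulus, |ψ i j x| ≤ M) →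
    (∀ j, ∀ x ∈ annulus, |∑ i, pd i (ψ i j) x - U j x| ≤ ε) →
    |∫ x, P x * ∑ j, U j x * pd j cut x| ≤ K + ε * ∫ x, |P x| * ∑ j, |pd j cut x| := by
  obtain ⟨χ, hχ, hχc, hχS, hχ1⟩ := exists_annulus_cutoff
  obtain ⟨D0, hD0, hv0⟩ := exists_uniform_bound (f := fun j => pd j cut)
    (fun j => continuous_of_contDiff (by fun_prop)) hasCompactSupport_pd_cut
  obtain ⟨D1, hD1, hv1⟩ := exists_uniform_bound (f := fun q : Fin 4 × Fin 4 => pd q.1 (pd q.2 cut))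
    (fun j => continuous_of_contDiff (by fun_prop))
    (fun q => hasCompactSupport_pd _ (hasCompactSupport_pd_cut _))
  obtain ⟨D2, hD2, hv2⟩ := exists_uniform_bound
    (f := fun q : Fin 4 × Fin 4 => pd q.1 (pd q.1 (pd q.2 cut)))
    (fun j => continuous_of_contDiff (by fun_prop))
    (fun q => hasCompactSupport_pd _ (hasCompactSupport_pd _ (hasCompactSupport_pd_cut _)))
  set D := D0 + D1 + D2 with hDdef
  have hD : 0 ≤ D := by positivity
  set L := 48 * (C * C * D) + C * (2 + M) * D + C * C * (1 + M) * D with hL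
  have hL0 : 0 ≤ L := by positivity
  set G := 2 * ∫ x, ∑ k, ((4 * M ^ 2 + (2 * C) ^ 2) * pd k χ x ^ 2 +
    (M ^ 2 + (2 * C) ^ 2) * χ x ^ 2) with hG
  refine ⟨L * (16 * (4 * (∫ x, χ x ^ 2) + G)), ?_⟩
  intro U P ε ψ h hUC hψ hanti hΔ hψM hε
  have hU := h.smooth_u
  have hP := h.smooth_p
  set v : Fin 4 → E4 → ℝ := fun j => pd j cut with hvdef
  have hv : ∀ j, ContDiff ℝ ∞ (v j) := fun j => by fun_prop
  have hvc : ∀ j, HasCompactSupport (v j) := hasCompactSupport_pd_cut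
  have main := h.integral_pressure hv hvc tsupport_pd_cut_subset_annulus
    (fun i j => pd_comm i j contDiff_cut) hψ hanti hΔ
  have hen : ∀ i j, ∫ x, χ x ^ 2 * ∑ k, pd k (ψ i j) x ^ 2 ≤ G := fun i j => by
    have hg : ∀ m, ContDiff ℝ ∞ (fun x => (if m = i then 1 else 0) * U j x -
      (if m = j then 1 else 0) * U i x) := fun m => by fun_prop
    refine integral_sq_mul_gradient_le (g := fun m x => (if m = i then 1 else 0) * U j x -
      (if m = j then 1 else 0) * U i x) (hψ i j) hg hχ hχc hχS (fun x hx => ?_) (hψM i j)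
      (fun x hx m => ?_)
    · rw [hΔ i j x hx]
      simp (disch := fun_prop) only [pd_sub, pd_const_mul]
      simp [Finset.sum_sub_distrib]
    · have h1 := hUC x hx i
      have h2 := hUC x hx j
      refine (abs_sub _ _).trans ?_
      simp only [abs_mul]
      split_ifs <;> simp <;> linarith
  have hχ2 : Integrable (fun x => χ x ^ 2) :=
    Continuous.integrable_of_hasCompactSupport (continuous_of_contDiff (by fun_prop))
      (HasCompactSupport.intro hχc fun x hx => by simp [image_eq_zero_of_notMem_tsupport hx])
  have hgr : ∀ i j, Integrable (fun x => χ x ^ 2 * ∑ k, pd k (ψ i j) x ^ 2) := fun i j =>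
    Continuous.integrable_of_hasCompactSupport (continuous_of_contDiff (by fun_prop))
      (HasCompactSupport.intro hχc fun x hx => by simp [image_eq_zero_of_notMem_tsupport hx])
  have hrem : |∫ x, remainder U v ψ x| ≤ L * (16 * (4 * (∫ x, χ x ^ 2) + G)) := by
    have hb : ∀ x, ‖remainder U v ψ x‖ ≤ L * ∑ i, ∑ j,
        (4 * χ x ^ 2 + χ x ^ 2 * ∑ k, pd k (ψ i j) x ^ 2) := by
      intro x
      rw [Real.norm_eq_abs]
      by_cases hx : x ∈ {x : E4 | 2 ≤ ‖x‖ ∧ ‖x‖ ≤ 3}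
      · have hxA : x ∈ annulus := ⟨by linarith [hx.1], by linarith [hx.2]⟩
        have := abs_remainder_le (v := v) (x := x) hC hD hM (hUC x hxA) (fun i j => hψM i j x hxA)
          (fun j => (hv0 j x).trans (by linarith)) (fun i j => (hv1 (i, j) x).trans (by linarith))
          (fun i j => (hv2 (i, j) x).trans (by linarith))
        refine this.trans_eq ?_
        rw [← hL, hχ1 x hx.1 hx.2]
        simp [Finset.sum_add_distrib]
      · have hx' : ∀ j, x ∉ tsupport (v j) := fun j hj => hx (tsupport_pd_cut_subset j hj)
        have z0 : ∀ j, v j x = 0 := fun j => image_eq_zero_of_notMem_tsupport (hx' j)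
        have z1 : ∀ i j, pd i (v j) x = 0 := fun i j => eq_zero_of_notMem_tsupport_pd i (hx' j)
        have z2 : ∀ i j, pd i (pd i (v j)) x = 0 := fun i j =>
          eq_zero_of_notMem_tsupport_pd i fun h => hx' j (tsupport_pd_subset i _ h)
        have : remainder U v ψ x = 0 := by simp [remainder, z0, z1, z2]
        rw [this, abs_zero]
        positivity
    have hi : ∀ i j, Integrable (fun x => 4 * χ x ^ 2 + χ x ^ 2 * ∑ k, pd k (ψ i j) x ^ 2) :=
      fun i j => (hχ2.const_mul 4).add (hgr i j)
    have hi' : ∀ i, Integrable (fun x => ∑ j, (4 * χ x ^ 2 + χ x ^ 2 * ∑ k, pd k (ψ i j) x ^ 2)) :=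
      fun i => integrable_finsetSum _ fun j _ => hi i j
    rw [← Real.norm_eq_abs]
    refine (norm_integral_le_of_norm_le ((integrable_finsetSum _ fun i _ => hi' i).const_mul L)
      (Eventually.of_forall hb)).trans ?_
    rw [integral_const_mul]
    refine mul_le_mul_of_nonneg_left ?_ hL0
    rw [integral_finsetSum _ fun i _ => hi' i]
    have : ∀ i ∈ (Finset.univ : Finset (Fin 4)),
        ∫ x, ∑ j, (4 * χ x ^ 2 + χ x ^ 2 * ∑ k, pd k (ψ i j) x ^ 2) ≤
        ∑ j : Fin 4, (4 * (∫ x, χ x ^ 2) + G) := fun i _ => by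
      rw [integral_finsetSum _ fun j _ => hi i j]
      refine Finset.sum_le_sum fun j _ => ?_
      rw [integral_add (hχ2.const_mul 4) (hgr i j), integral_const_mul]
      linarith [hen i j]
    refine (Finset.sum_le_sum this).trans_eq ?_
    simp
    ring
  have j1 : Integrable (fun x => P x * ∑ j, (∑ i, pd i (ψ i j) x) * v j x) :=
    Continuous.integrable_of_hasCompactSupport (continuous_of_contDiff (by fun_prop))
      (HasCompactSupport.intro (isCompact_iUnion hvc) fun x hx => by
        have hx' : ∀ i, v i x = 0 := fun i =>
          image_eq_zero_of_notMem_tsupport fun hi => hx (Set.mem_iUnion.2 ⟨i, hi⟩)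
        simp [hx'])
  have j2 : Integrable (fun x => P x * ∑ j, (∑ i, pd i (ψ i j) x - U j x) * v j x) :=
    Continuous.integrable_of_hasCompactSupport (continuous_of_contDiff (by fun_prop))
      (HasCompactSupport.intro (isCompact_iUnion hvc) fun x hx => by
        have hx' : ∀ i, v i x = 0 := fun i =>
          image_eq_zero_of_notMem_tsupport fun hi => hx (Set.mem_iUnion.2 ⟨i, hi⟩)
        simp [hx'])
  have j3 : Integrable (fun x => |P x| * ∑ j, |v j x|) :=
    Continuous.integrable_of_hasCompactSupport
      (hP.continuous.abs.mul (continuous_finsetSum _ fun j _ => (hv j).continuous.abs))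
      (HasCompactSupport.intro (isCompact_iUnion hvc) fun x hx => by
        have hx' : ∀ i, v i x = 0 := fun i =>
          image_eq_zero_of_notMem_tsupport fun hi => hx (Set.mem_iUnion.2 ⟨i, hi⟩)
        simp [hx'])
  have herr : |∫ x, P x * ∑ j, (∑ i, pd i (ψ i j) x - U j x) * v j x| ≤
      ε * ∫ x, |P x| * ∑ j, |v j x| := by
    rw [← integral_const_mul, ← Real.norm_eq_abs]
    refine norm_integral_le_of_norm_le (j3.const_mul ε) (Eventually.of_forall fun x => ?_)
    rw [Real.norm_eq_abs, abs_mul, mul_left_comm, Finset.mul_sum]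
    refine mul_le_mul_of_nonneg_left ?_ (abs_nonneg _)
    refine (Finset.abs_sum_le_sum_abs _ _).trans (Finset.sum_le_sum fun j _ => ?_)
    rw [abs_mul]
    by_cases hx : x ∈ annulus
    · gcongr
      exact hε j x hx
    · have hz : v j x = 0 :=
        image_eq_zero_of_notMem_tsupport fun h => hx (tsupport_pd_cut_subset_annulus j h)
      rw [hz]
      simp
  have hsplit : ∫ x, P x * ∑ j, U j x * v j x =
      (∫ x, P x * ∑ j, (∑ i, pd i (ψ i j) x) * v j x) -
        ∫ x, P x * ∑ j, (∑ i, pd i (ψ i j) x - U j x) * v j x := by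
    rw [← integral_sub j1 j2]
    congr 1
    ext x
    simp only [sub_mul, Finset.sum_sub_distrib]
    ring
  rw [hsplit, main]
  exact (abs_sub _ _).trans (add_le_add hrem herr)

lemma pd_cut_eq_zero_of_lt (k : Fin 4) {x : E4} (hx : ‖x‖ < 2) : pd k cut x = 0 :=
  image_eq_zero_of_notMem_tsupport fun h => absurd (tsupport_pd_cut_subset k h).1 hx.not_ge

lemma pd_cut_eq_zero_of_gt (k : Fin 4) {x : E4} (hx : 3 < ‖x‖) : pd k cut x = 0 :=
  image_eq_zero_of_notMem_tsupport fun h => absurd (tsupport_pd_cut_subset k h).2 hx.not_ge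

lemma norm_smul_of_pos {r : ℝ} (hr : 0 < r) (x : E4) : ‖r • x‖ = r * ‖x‖ := by
  rw [norm_smul, Real.norm_of_nonneg hr.le]

/-- A cutoff function equal to `1` on `3 / a ≤ |x| ≤ 2 / b` and to `0` for `|x| ≤ 2 / a` and for
`3 / b ≤ |x|`. -/
noncomputable def shell (a b : ℝ) (x : E4) : ℝ := cut (a • x) - cut (b • x)

lemma contDiff_shell (a b : ℝ) : ContDiff ℝ ∞ (shell a b) :=
  (contDiff_cut.comp (contDiff_const_smul _)).sub (contDiff_cut.comp (contDiff_const_smul _))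

lemma pd_shell (i : Fin 4) (a b : ℝ) (x : E4) :
    pd i (shell a b) x = a * pd i cut (a • x) - b * pd i cut (b • x) := by
  have h : shell a b = fun x => cut (a • x) - cut (b • x) := rfl
  have hs : ∀ c : ℝ, ContDiff ℝ ∞ (fun x : E4 => cut (c • x)) := fun c =>
    contDiff_cut.comp (contDiff_const_smul _)
  rw [h, pd_sub (hs a) (hs b)]
  simp only [pd_comp_smul]

lemma abs_shell_le_one (a b : ℝ) (x : E4) : |shell a b x| ≤ 1 :=
  abs_le.2 ⟨by rw [shell]; linarith [cut_nonneg (a • x), cut_le_one (b • x)],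
    by rw [shell]; linarith [cut_nonneg (b • x), cut_le_one (a • x)]⟩

lemma shell_eq_zero_of_small {a b : ℝ} (hb : 0 < b) (hab : b ≤ a) {x : E4} (hx : a * ‖x‖ ≤ 2) :
    shell a b x = 0 := by
  have : b * ‖x‖ ≤ a * ‖x‖ := by gcongr
  rw [shell, cut_eq_zero (by rw [norm_smul_of_pos (hb.trans_le hab)]; exact hx),
    cut_eq_zero (by rw [norm_smul_of_pos hb]; linarith), sub_self]

lemma shell_eq_zero_of_large {a b : ℝ} (hb : 0 < b) (hab : b ≤ a) {x : E4} (hx : 3 ≤ b * ‖x‖) :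
    shell a b x = 0 := by
  have : b * ‖x‖ ≤ a * ‖x‖ := by gcongr
  rw [shell, cut_eq_one (by rw [norm_smul_of_pos (hb.trans_le hab)]; linarith),
    cut_eq_one (by rw [norm_smul_of_pos hb]; exact hx), sub_self]

lemma shell_eq_one {a b : ℝ} (ha : 0 < a) (hb : 0 < b) {x : E4} (h3 : 3 ≤ a * ‖x‖)
    (h2 : b * ‖x‖ ≤ 2) : shell a b x = 1 := by
  rw [shell, cut_eq_one (by rw [norm_smul_of_pos ha]; exact h3),
    cut_eq_zero (by rw [norm_smul_of_pos hb]; exact h2), sub_zero]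

lemma tsupport_shell_subset {a b : ℝ} (hb : 0 < b) (hab : b ≤ a) :
    tsupport (shell a b) ⊆ {x | 2 ≤ a * ‖x‖ ∧ b * ‖x‖ ≤ 3} := by
  have hcl : IsClosed {x : E4 | 2 ≤ a * ‖x‖ ∧ b * ‖x‖ ≤ 3} :=
    (isClosed_le continuous_const (continuous_const.mul continuous_norm)).inter
      (isClosed_le (continuous_const.mul continuous_norm) continuous_const)
  refine closure_minimal (fun x hx => ?_) hcl
  by_contra hc
  rcases not_and_or.1 hc with h | h
  · exact hx (shell_eq_zero_of_small hb hab (not_le.1 h).le)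
  · exact hx (shell_eq_zero_of_large hb hab (not_le.1 h).le)

lemma hasCompactSupport_shell {a b : ℝ} (hb : 0 < b) (hab : b ≤ a) :
    HasCompactSupport (shell a b) :=
  (isCompact_closedBall (0 : E4) (3 / b)).of_isClosed_subset (isClosed_tsupport _)
    ((tsupport_shell_subset hb hab).trans fun x hx => by
      rw [mem_closedBall_zero_iff, le_div_iff₀ hb]
      linarith [hx.2])

lemma IsSol.exists_truncation {C G : ℝ} {u : Fin 4 → E4 → ℝ} {p : E4 → ℝ} (h : IsSol C u p)
    (hC : 0 ≤ C) (hG : 0 ≤ G) (hcut : ∀ k x, |pd k cut x| ≤ G) {n : ℕ} (hn : 6 ≤ n) :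
    ∃ H : Fin 4 → E4 → ℝ, (∀ j, ContDiff ℝ ∞ (H j)) ∧ (∀ j, HasCompactSupport (H j)) ∧
      (∀ j, ∀ x ∈ annulus, H j x = u j x) ∧ (∀ j y, y ≠ 0 → |H j y| ≤ C * (1 / ‖y‖)) ∧
      (∀ y, ‖y‖ ≤ 3 / n → |∑ i, pd i (H i) y| ≤ 2 * C * G * n ^ 2) ∧
      (∀ y, 2 * n ≤ ‖y‖ → |∑ i, pd i (H i) y| ≤ 2 * C * G / n ^ 2) ∧
      (∀ y, 3 / n < ‖y‖ → ‖y‖ < 2 * n → ∑ i, pd i (H i) y = 0) ∧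
      ∀ y, 3 * n < ‖y‖ → ∑ i, pd i (H i) y = 0 := by
  have hn6 : (6 : ℝ) ≤ n := by exact_mod_cast hn
  have hn0 : (0 : ℝ) < n := by linarith
  have hi0 : 0 < (1 / n : ℝ) := by positivity
  have hin : (1 / n : ℝ) ≤ n := by
    rw [div_le_iff₀ hn0]; nlinarith
  have hi1 : (1 / n : ℝ) ≤ 1 / 6 := one_div_le_one_div_of_le (by norm_num) hn6
  have hni : (n : ℝ) * (1 / n) = 1 := by field_simp
  obtain ⟨V, Q, hV, hVu, -⟩ := h.exists_isSolOn hi0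
  have hVs := hV.smooth_u
  set η := shell n (1 / n) with hη
  have hηs : ContDiff ℝ ∞ η := contDiff_shell _ _
  have small : ∀ x : E4, ¬ (1 / n : ℝ) < ‖x‖ → η x = 0 := fun x hx =>
    shell_eq_zero_of_small hi0 hin (by
      have := mul_le_mul_of_nonneg_left (not_lt.1 hx) hn0.le
      linarith)
  have hD : ∀ y, ∑ i, pd i (fun x => η x * V i x) y = ∑ i, pd i η y * V i y := fun y => by
    simp only [pd_mul hηs (hVs _), Finset.sum_add_distrib, ← Finset.mul_sum]
    by_cases hy : (1 / n : ℝ) < ‖y‖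
    · rw [hV.div y hy, mul_zero, add_zero]
    · rw [small y hy, zero_mul, add_zero]
  have n1 : ∀ x : E4, ‖(n : ℝ) • x‖ = n * ‖x‖ := norm_smul_of_pos hn0
  have n2 : ∀ x : E4, ‖(1 / n : ℝ) • x‖ = 1 / n * ‖x‖ := norm_smul_of_pos hi0
  have hVb : ∀ y i, (1 / n : ℝ) < ‖y‖ → |V i y| ≤ C / ‖y‖ := fun y i hy => by
    rw [hVu i y hy]
    exact h.bound y (norm_pos_iff.1 (hi0.trans hy)) i
  have inner : ∀ i (y : E4), ‖y‖ < 2 * n → pd i cut ((1 / n : ℝ) • y) = 0 := fun i y hy =>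
    pd_cut_eq_zero_of_lt i (by
      rw [n2, one_div_mul_eq_div, div_lt_iff₀ hn0]
      exact hy)
  have outer : ∀ i (y : E4), 3 / n < ‖y‖ → pd i cut ((n : ℝ) • y) = 0 := fun i y hy =>
    pd_cut_eq_zero_of_gt i (by
      rw [n1]
      rwa [div_lt_iff₀' hn0] at hy)
  have hbig : ∀ y : E4, 2 * n ≤ ‖y‖ → 3 / (n : ℝ) < ‖y‖ := fun y hy => by
    have : 3 / (n : ℝ) ≤ 1 := by rw [div_le_one hn0]; linarith
    linarith
  refine ⟨fun j x => η x * V j x, fun j => hηs.mul (hVs j), fun j =>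
    (hasCompactSupport_shell hi0 hin).mul_right, fun j x hx => ?_, fun j y hy => ?_,
    fun y hy => ?_, fun y hy => ?_, fun y h3 h2 => ?_, fun y hy => ?_⟩
  · have h1 : (1 / n : ℝ) < ‖x‖ := by linarith [hx.1]
    simp only
    rw [hVu j x h1, hη, shell_eq_one hn0 hi0 (by nlinarith [hx.1]), one_mul]
    rw [one_div_mul_eq_div, div_le_iff₀ hn0]
    linarith [hx.2]
  · have : 0 < ‖y‖ := norm_pos_iff.2 hy
    by_cases hy1 : (1 / n : ℝ) < ‖y‖
    · rw [abs_mul, mul_one_div]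
      calc |η y| * |V j y| ≤ 1 * (C / ‖y‖) :=
            mul_le_mul (abs_shell_le_one _ _ _) (hVb y j hy1) (abs_nonneg _) zero_le_one
        _ = _ := one_mul _
    · simp only
      rw [small y hy1, zero_mul, abs_zero]
      positivity
  · rw [hD]
    have hlt : ‖y‖ < 2 * n := by
      have : 3 / (n : ℝ) ≤ 1 := by rw [div_le_one hn0]; linarith
      linarith
    simp only [hη, pd_shell, inner _ y hlt, mul_zero, sub_zero]
    by_cases hs : (n : ℝ) * ‖y‖ < 2
    · have : ∀ i, pd i cut ((n : ℝ) • y) = 0 := fun i => pd_cut_eq_zero_of_lt i (by rw [n1]; exact hs)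
      simp only [this, mul_zero, zero_mul, Finset.sum_const_zero, abs_zero]
      positivity
    · have hy2 : 2 / (n : ℝ) ≤ ‖y‖ := by
        rw [div_le_iff₀' hn0]; exact not_lt.1 hs
      have hy1 : (1 / n : ℝ) < ‖y‖ := lt_of_lt_of_le (by gcongr; norm_num) hy2
      have hb : C / ‖y‖ ≤ C * n / 2 := by
        rw [div_le_iff₀ (hi0.trans hy1)]
        have := mul_le_mul_of_nonneg_left (not_lt.1 hs) hC
        linarith
      refine (Finset.abs_sum_le_sum_abs _ _).trans ?_
      refine (Finset.sum_le_sum (g := fun _ : Fin 4 => n * G * (C * n / 2)) fun i _ => ?_).trans_eq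
        (by simp; ring)
      rw [abs_mul, abs_mul, abs_of_pos hn0]
      gcongr
      exacts [hcut _ _, (hVb y i hy1).trans hb]
  · rw [hD]
    simp only [hη, pd_shell, outer _ y (hbig y hy), mul_zero, zero_sub]
    have hy1 : (1 / n : ℝ) < ‖y‖ := by linarith
    have hb : C / ‖y‖ ≤ C / (2 * n) := by gcongr
    refine (Finset.abs_sum_le_sum_abs _ _).trans ?_
    refine (Finset.sum_le_sum (g := fun _ : Fin 4 => 1 / n * G * (C / (2 * n)))
      fun i _ => ?_).trans_eq (by simp; field_simp; ring)
    rw [abs_mul, abs_neg, abs_mul, abs_of_pos hi0]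
    gcongr
    exacts [hcut _ _, (hVb y i hy1).trans hb]
  · rw [hD]
    simp only [hη, pd_shell, outer _ y h3, inner _ y h2, mul_zero, sub_zero, zero_mul,
      Finset.sum_const_zero]
  · rw [hD]
    have : ∀ i, pd i cut ((1 / n : ℝ) • y) = 0 := fun i => pd_cut_eq_zero_of_gt i (by
      rw [n2, one_div_mul_eq_div, lt_div_iff₀ hn0]
      exact hy)
    simp only [hη, pd_shell, outer _ y (hbig y (by linarith)), this, mul_zero, sub_zero, zero_mul,
      Finset.sum_const_zero]

/-- Every velocity field is, up to a small error on the annulus, the divergence of a bounded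
antisymmetric matrix field. -/
lemma exists_antisymm_potential {C : ℝ} (hC : 0 ≤ C) : ∃ M E : ℝ, 0 ≤ M ∧
    ∀ (u : Fin 4 → E4 → ℝ) (p : E4 → ℝ), IsSol C u p → ∀ U : Fin 4 → E4 → ℝ,
    (∀ j, ∀ x ∈ annulus, U j x = u j x) → ∀ n : ℕ, 6 ≤ n →
    ∃ ψ : Fin 4 → Fin 4 → E4 → ℝ, (∀ i j, ContDiff ℝ ∞ (ψ i j)) ∧
      (∀ i j x, ψ i j x = - ψ j i x) ∧
      (∀ i j, ∀ x ∈ annulus, ∑ k, pd k (pd k (ψ i j)) x = pd i (U j) x - pd j (U i) x) ∧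
      (∀ i j, ∀ x ∈ annulus, |ψ i j x| ≤ M) ∧
      ∀ j, ∀ x ∈ annulus, |∑ i, pd i (ψ i j) x - U j x| ≤ E / n := by
  obtain ⟨G, hG, hcut⟩ := exists_uniform_bound (f := fun j => pd j cut)
    (fun j => continuous_of_contDiff (by fun_prop)) hasCompactSupport_pd_cut
  choose A hA0 hA using exists_gradKer_oscillation_bound
  choose A' hA0' hA' using exists_gradKer_tail_bound
  have hm : 0 < newtonMass⁻¹ := inv_pos.2 newtonMass_pos
  refine ⟨2 * (newtonMass⁻¹ * ((∑ i, A i) * C)), newtonMass⁻¹ * ((∑ i, A' i) * (2 * C * G)),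
    ?_, ?_⟩
  · have : 0 ≤ ∑ i, A i := Finset.sum_nonneg fun i _ => hA0 i
    positivity
  intro u p h U hUu n hn
  obtain ⟨H, hH, hHc, hHu, hHb, d1, d2, d3, d4⟩ := h.exists_truncation hC hG hcut hn
  have hn0 : (0 : ℝ) < n := by
    have : (6 : ℝ) ≤ n := by exact_mod_cast hn
    linarith
  set b : Fin 4 → E4 → ℝ := fun j => newtonPot (H j) with hb
  have hbs : ∀ j, ContDiff ℝ ∞ (b j) := fun j => contDiff_newtonPot (hH j) (hHc j)
  have hpb : ∀ i j, pd i (b j) = newtonPot (pd i (H j)) := fun i j => pd_newtonPot i (hH j) (hHc j)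
  set e : E4 := EuclideanSpace.single 0 2 with he
  have hen : ‖e‖ = 2 := by simp [he]
  have hosc : ∀ i j, ∀ x ∈ annulus,
      |pd i (b j) x - pd i (b j) e| ≤ newtonMass⁻¹ * ((∑ i, A i) * C) := fun i j x hx => by
    rw [hpb, newtonPot_pd i (hH j) (hHc j), newtonPot_pd i (hH j) (hHc j), ← mul_sub, abs_mul,
      abs_neg, abs_of_pos hm]
    gcongr
    refine (hA i C (H j) hC (hH j).continuous (hHc j) (hHb j) x e hx.1.le hx.2.le
      (by rw [hen]; norm_num) (by rw [hen]; norm_num)).trans ?_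
    gcongr
    exact Finset.single_le_sum (fun i _ => hA0 i) (Finset.mem_univ i)
  have hHU : ∀ j, ∀ x ∈ annulus, H j x = U j x := fun j x hx => by rw [hHu j x hx, hUu j x hx]
  have hψp : ∀ k i j, pd k (fun x => pd i (b j) x - pd j (b i) x -
      (pd i (b j) e - pd j (b i) e)) = fun x => pd k (pd i (b j)) x - pd k (pd j (b i)) x := by
    intro k i j
    simp (disch := fun_prop) only [pd_sub, pd_const, sub_zero]
  refine ⟨fun i j x => pd i (b j) x - pd j (b i) x - (pd i (b j) e - pd j (b i) e),
    fun i j => by fun_prop, fun i j x => by ring, fun i j x hx => ?_, fun i j x hx => ?_,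
    fun j x hx => ?_⟩
  · have hl : ∀ i j, ∑ k, pd k (pd k (pd i (b j))) x = pd i (U j) x := fun i j => by
      rw [hpb, laplacian_newtonPot (contDiff_pd i (hH j)) (hasCompactSupport_pd i (hHc j))]
      exact pd_congr_on isOpen_annulus (hHU j) x hx
    simp (disch := fun_prop) only [hψp, pd_sub, Finset.sum_sub_distrib, hl]
  · simp only
    rw [sub_sub_sub_comm]
    refine (abs_sub _ _).trans ?_
    linarith [hosc i j x hx, hosc j i x hx]
  · have e1 : ∑ i, pd i (pd i (b j)) x = U j x := by
      rw [← hHU j x hx]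
      exact laplacian_newtonPot (hH j) (hHc j) x
    have e2 : ∀ i, pd i (pd j (b i)) x =
        -newtonMass⁻¹ * ∫ y, gradKer j (x - y) * pd i (H i) y := fun i => by
      rw [hpb, pd_newtonPot i (contDiff_pd j (hH i)) (hasCompactSupport_pd j (hHc i)),
        pd_comm i j (hH i), newtonPot_pd j (contDiff_pd i (hH i)) (hasCompactSupport_pd i (hHc i))]
    have e3 : ∑ i, pd i (pd j (b i)) x =
        -newtonMass⁻¹ * ∫ y, gradKer j (x - y) * ∑ i, pd i (H i) y := by
      simp only [e2, ← Finset.mul_sum]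
      rw [← integral_finsetSum _ fun i _ => integrable_gradKer_mul j
        (contDiff_pd i (hH i)).continuous (hasCompactSupport_pd i (hHc i)) x]
      simp only [Finset.mul_sum]
    simp only [hψp, Finset.sum_sub_distrib, e1, e3]
    rw [show ∀ a c : ℝ, a - c - a = - c from fun a c => by ring, abs_neg, abs_mul, abs_neg,
      abs_of_pos hm, mul_div_assoc]
    gcongr
    refine (hA' j (2 * C * G) n (fun y => ∑ i, pd i (H i) y) (by positivity) hn d1 d2 d3 d4 x
      hx.1.le hx.2.le).trans ?_
    gcongr
    exact Finset.single_le_sum (fun i _ => hA0' i) (Finset.mem_univ j)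

/-- The energy flux through the unit scale is bounded in terms of `C` only. -/
lemma exists_flux_bound {C : ℝ} (hC : 0 ≤ C) : ∃ M : ℝ, ∀ (u : Fin 4 → E4 → ℝ) (p : E4 → ℝ),
    IsSol C u p → |∫ x, fluxDensity u p cut x| ≤ M := by
  obtain ⟨M, E, hM, hME⟩ := exists_antisymm_potential hC
  obtain ⟨K, hK⟩ := exists_pressure_bound hC hM
  set W : E4 → ℝ := fun x => (2 * C ^ 2) * ∑ k, |pd k (pd k cut) x| +
    (2 * C ^ 3) * ∑ k, |pd k cut x| with hW
  refine ⟨(∫ x, W x) + K, fun u p h => ?_⟩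
  obtain ⟨U, P, hUP, hUu, hPp⟩ := h.exists_isSolOn one_pos
  have hU := hUP.smooth_u
  have hP := hUP.smooth_p
  have hsol : IsSolOn annulus U P := hUP.mono fun x hx => hx.1
  have hUA : ∀ j, ∀ x ∈ annulus, U j x = u j x := fun j x hx => hUu j x hx.1
  have hUC : ∀ x ∈ annulus, ∀ j, |U j x| ≤ C := fun x hx j => by
    rw [hUA j x hx]
    exact (h.bound x (norm_pos_iff.1 (zero_lt_one.trans hx.1)) j).trans
      (div_le_self hC hx.1.le)
  have hpress : |∫ x, P x * ∑ j, U j x * pd j cut x| ≤ K := by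
    set Q := ∫ x, |P x| * ∑ j, |pd j cut x|
    have hlim : Tendsto (fun n : ℕ => K + E / n * Q) atTop (𝓝 (K + 0 * Q)) :=
      ((tendsto_const_div_atTop_nhds_zero_nat E).mul_const Q).const_add K
    rw [zero_mul, add_zero] at hlim
    refine ge_of_tendsto hlim ?_
    filter_upwards [eventually_ge_atTop 6] with n hn
    obtain ⟨ψ, h1, h2, h3, h4, h5⟩ := hME u p h U hUA n hn
    exact hK U P (E / n) ψ hsol hUC h1 h2 h3 h4 h5
  have z0 : ∀ x, x ∉ annulus → ∀ k, pd k cut x = 0 := fun x hx k =>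
    image_eq_zero_of_notMem_tsupport fun h => hx (tsupport_pd_cut_subset_annulus k h)
  have z1 : ∀ x, x ∉ annulus → ∀ k, pd k (pd k cut) x = 0 := fun x hx k =>
    eq_zero_of_notMem_tsupport_pd k fun h => hx (tsupport_pd_cut_subset_annulus k h)
  have heq : fluxDensity u p cut = fluxDensity U P cut := by
    ext x
    by_cases hx : x ∈ annulus
    · simp only [fluxDensity, hUA _ x hx, hPp x hx.1]
    · simp only [fluxDensity, z0 x hx, z1 x hx, mul_zero, Finset.sum_const_zero]
  set R : E4 → ℝ := fun x => (1 / 2 * ∑ j, U j x ^ 2) * ∑ k, pd k (pd k cut) x +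
    (1 / 2 * ∑ j, U j x ^ 2) * ∑ k, U k x * pd k cut x with hR
  have hsplit : fluxDensity U P cut = fun x => R x + P x * ∑ j, U j x * pd j cut x := by
    ext x
    simp only [fluxDensity, hR]
    ring
  have hK' : IsCompact (⋃ j, tsupport (pd j cut)) := isCompact_iUnion hasCompactSupport_pd_cut
  have t0 : ∀ x, x ∉ (⋃ j, tsupport (pd j cut)) →
      (∀ k, pd k cut x = 0) ∧ ∀ k, pd k (pd k cut) x = 0 := fun x hx => by
    have hx' : ∀ j, x ∉ tsupport (pd j cut) := fun j hj => hx (Set.mem_iUnion.2 ⟨j, hj⟩)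
    exact ⟨fun k => image_eq_zero_of_notMem_tsupport (hx' k),
      fun k => eq_zero_of_notMem_tsupport_pd k (hx' k)⟩
  have i1 : Integrable R := Continuous.integrable_of_hasCompactSupport
    (continuous_of_contDiff (by fun_prop))
    (HasCompactSupport.intro hK' fun x hx => by simp [hR, t0 x hx])
  have i2 : Integrable (fun x => P x * ∑ j, U j x * pd j cut x) :=
    Continuous.integrable_of_hasCompactSupport (continuous_of_contDiff (by fun_prop))
    (HasCompactSupport.intro hK' fun x hx => by simp [t0 x hx])
  have i3 : Integrable W := Continuous.integrable_of_hasCompactSupport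
    ((continuous_const.mul (continuous_finsetSum _ fun k _ =>
      (continuous_of_contDiff (by fun_prop : ContDiff ℝ ∞ (pd k (pd k cut)))).abs)).add
      (continuous_const.mul (continuous_finsetSum _ fun k _ =>
      (continuous_of_contDiff (by fun_prop : ContDiff ℝ ∞ (pd k cut))).abs)))
    (HasCompactSupport.intro hK' fun x hx => by simp [hW, t0 x hx])
  have hRW : |∫ x, R x| ≤ ∫ x, W x := by
    rw [← Real.norm_eq_abs]
    refine norm_integral_le_of_norm_le i3 (Eventually.of_forall fun x => ?_)
    rw [Real.norm_eq_abs]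
    by_cases hx : x ∈ annulus
    · have he : |1 / 2 * ∑ j, U j x ^ 2| ≤ 2 * C ^ 2 := by
        rw [abs_of_nonneg (by positivity)]
        have : ∑ j, U j x ^ 2 ≤ ∑ j : Fin 4, C ^ 2 := Finset.sum_le_sum fun j _ =>
          sq_le_sq' (abs_le.1 (hUC x hx j)).1 (abs_le.1 (hUC x hx j)).2
        simp only [Finset.sum_const, Finset.card_univ, Fintype.card_fin, nsmul_eq_mul] at this
        push_cast at this
        linarith
      have h1 : |∑ k, U k x * pd k cut x| ≤ C * ∑ k, |pd k cut x| := by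
        rw [Finset.mul_sum]
        refine (Finset.abs_sum_le_sum_abs _ _).trans (Finset.sum_le_sum fun k _ => ?_)
        rw [abs_mul]
        gcongr
        exact hUC x hx k
      refine (abs_add_le _ _).trans ((add_le_add (abs_mul _ _).le (abs_mul _ _).le).trans ?_)
      refine (add_le_add (mul_le_mul he (Finset.abs_sum_le_sum_abs _ _) (abs_nonneg _)
        (by positivity)) (mul_le_mul he h1 (abs_nonneg _) (by positivity))).trans_eq ?_
      simp only [hW]
      ring
    · simp [hR, hW, z0 x hx, z1 x hx]
  rw [heq, hsplit, integral_add i1 i2]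
  exact (abs_add_le _ _).trans (add_le_add hRW hpress)

lemma pd_const_mul_comp_smul (i : Fin 4) (f : E4 → ℝ) (c r : ℝ) (x : E4) :
    pd i (fun y => c * f (r • y)) x = c * r * pd i f (r • x) := by
  rw [mul_assoc, ← pd_comp_smul]
  change fderiv ℝ (c • fun y : E4 => f (r • y)) x _ = _
  rw [fderiv_const_smul_field]
  rfl

/-- Solutions are invariant under the natural scaling. -/
lemma IsSol.rescale {C : ℝ} {u : Fin 4 → E4 → ℝ} {p : E4 → ℝ} (h : IsSol C u p) {r : ℝ}
    (hr : 0 < r) : IsSol C (fun j x => r * u j (r • x)) (fun x => r ^ 2 * p (r • x)) := by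
  have hne : ∀ x : E4, x ≠ 0 → r • x ≠ 0 := fun x hx => smul_ne_zero hr.ne' hx
  have h1 : ∀ i j, pd i (fun x => r * u j (r • x)) = fun x => r * r * pd i (u j) (r • x) :=
    fun i j => funext fun x => pd_const_mul_comp_smul i (u j) r r x
  refine ⟨fun j => contDiffOn_const.mul ((h.smooth_u j).comp
    (contDiff_const_smul r).contDiffOn hne), contDiffOn_const.mul (h.smooth_p.comp
    (contDiff_const_smul r).contDiffOn hne), fun x hx j => ?_, fun x hx => ?_, fun x hx j => ?_⟩
  · have ns := h.ns (r • x) (hne x hx) j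
    simp only [h1, pd_const_mul_comp_smul]
    simp only [Fin.sum_univ_four] at ns ⊢
    linear_combination r ^ 3 * ns
  · have dv := h.div (r • x) (hne x hx)
    simp only [h1, ← Finset.mul_sum, dv, mul_zero]
  · have hb := h.bound (r • x) (hne x hx) j
    rw [norm_smul_of_pos hr, mul_comm r, ← div_div, le_div_iff₀ hr] at hb
    rwa [abs_mul, abs_of_pos hr, mul_comm]

lemma fluxDensity_rescale (u : Fin 4 → E4 → ℝ) (p : E4 → ℝ) {a r : ℝ} (har : r * a = 1) (x : E4) :
    fluxDensity u p (fun y => cut (a • y)) x =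
      a ^ 4 * fluxDensity (fun j x => r * u j (r • x)) (fun x => r ^ 2 * p (r • x)) cut (a • x) := by
  have h1 : ∀ k, pd k (fun y => cut (a • y)) = fun x => a * pd k cut (a • x) :=
    fun k => funext fun x => pd_comp_smul k cut a x
  simp only [fluxDensity, h1, pd_const_mul_comp_smul, pd_comp_smul, smul_smul, har, one_smul,
    Fin.sum_univ_four]
  have hr : r ≠ 0 := left_ne_zero_of_mul_eq_one har
  obtain rfl : a = r⁻¹ := eq_inv_of_mul_eq_one_right har
  field_simp

lemma integral_fluxDensity_rescale (u : Fin 4 → E4 → ℝ) (p : E4 → ℝ) {a r : ℝ} (ha : 0 < a)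
    (har : r * a = 1) : ∫ x, fluxDensity u p (fun y => cut (a • y)) x =
      ∫ x, fluxDensity (fun j x => r * u j (r • x)) (fun x => r ^ 2 * p (r • x)) cut x := by
  simp only [fluxDensity_rescale u p har, integral_const_mul]
  rw [Measure.integral_comp_smul volume
    (fluxDensity (fun j x => r * u j (r • x)) (fun x => r ^ 2 * p (r • x)) cut)]
  simp only [finrank_euclideanSpace, Fintype.card_fin, smul_eq_mul, abs_inv, abs_pow,
    abs_of_pos ha]
  field_simp

lemma contDiff_cut_smul (a : ℝ) : ContDiff ℝ ∞ fun x : E4 => cut (a • x) :=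
  contDiff_cut.comp (contDiff_const_smul _)

lemma shell_nonneg {a b : ℝ} (hb : 0 < b) (hab : 2 * b ≤ a) (x : E4) : 0 ≤ shell a b x := by
  rw [shell, sub_nonneg]
  rcases le_or_gt (b * ‖x‖) 2 with h | h
  · rw [cut_eq_zero (by rwa [norm_smul_of_pos hb])]
    exact cut_nonneg _
  · have : 2 * b * ‖x‖ ≤ a * ‖x‖ := by gcongr
    rw [cut_eq_one (x := a • x) (by rw [norm_smul_of_pos (by linarith)]; linarith)]
    exact cut_le_one _

/-- The Dirichlet energy on shells is bounded independently of the shell. -/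
lemma IsSol.setIntegral_energy_le {C M : ℝ} {u : Fin 4 → E4 → ℝ} {p : E4 → ℝ}
    (h : IsSol C u p) (hM : ∀ (u : Fin 4 → E4 → ℝ) (p : E4 → ℝ), IsSol C u p →
      |∫ x, fluxDensity u p cut x| ≤ M) {a b : ℝ} (hb : 0 < b) (hab : 2 * b ≤ a) :
    IntegrableOn (fun x => ∑ i, ∑ j, pd i (u j) x ^ 2) {x | 3 ≤ a * ‖x‖ ∧ b * ‖x‖ ≤ 2} ∧
    ∫ x in {x | 3 ≤ a * ‖x‖ ∧ b * ‖x‖ ≤ 2}, ∑ i, ∑ j, pd i (u j) x ^ 2 ≤ 2 * M := by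
  have ha : 0 < a := by linarith
  have hba : b ≤ a := by linarith
  obtain ⟨U, P, hUP, hUu, hPp⟩ := h.exists_isSolOn (one_div_pos.2 ha)
  have hU := hUP.smooth_u
  have hP := hUP.smooth_p
  have hS : IsOpen {x : E4 | 1 / a < ‖x‖} := isOpen_lt continuous_const continuous_norm
  have hpd : ∀ i j, ∀ x ∈ {x : E4 | 1 / a < ‖x‖}, pd i (U j) x = pd i (u j) x := fun i j =>
    pd_congr_on hS (hUu j)
  have hmem : ∀ x : E4, 2 ≤ a * ‖x‖ → 1 / a < ‖x‖ := fun x hx => by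
    rw [div_lt_iff₀' ha]
    linarith
  have hφ := contDiff_shell a b
  have hφc := hasCompactSupport_shell hb hba
  have hen := hUP.integral_energy hφ hφc
    ((tsupport_shell_subset hb hba).trans fun x hx => hmem x hx.1)
  have flux : ∀ c, 0 < c → c ≤ a → (Integrable fun x => fluxDensity U P (fun y => cut (c • y)) x) ∧
      |∫ x, fluxDensity U P (fun y => cut (c • y)) x| ≤ M := fun c hc hca => by
    have h1 : ∀ k, pd k (fun y => cut (c • y)) = fun x => c * pd k cut (c • x) :=
      fun k => funext fun x => pd_comp_smul k cut c x
    have hz : ∀ x : E4, (c * ‖x‖ < 2 ∨ 3 < c * ‖x‖) → ∀ k, pd k cut (c • x) = 0 ∧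
        pd k (pd k cut) (c • x) = 0 := fun x hx k => by
      have hx' : c • x ∉ tsupport (pd k cut) := fun hm => by
        have := tsupport_pd_cut_subset k hm
        rw [Set.mem_ofPred_eq, norm_smul_of_pos hc] at this
        rcases hx with hx | hx
        · exact absurd this.1 hx.not_ge
        · exact absurd this.2 hx.not_ge
      exact ⟨image_eq_zero_of_notMem_tsupport hx', eq_zero_of_notMem_tsupport_pd k hx'⟩
    have heq : fluxDensity U P (fun y => cut (c • y)) = fluxDensity u p (fun y => cut (c • y)) := by
      ext x
      rcases lt_or_ge (c * ‖x‖) 2 with hx | hx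
      · simp only [fluxDensity, h1, pd_const_mul_comp_smul, hz x (Or.inl hx), mul_zero,
          Finset.sum_const_zero]
      · have : c * ‖x‖ ≤ a * ‖x‖ := by gcongr
        have hx' := hmem x (hx.trans this)
        simp only [fluxDensity, hUu _ x hx', hPp x hx']
    have hcs := contDiff_cut_smul c
    refine ⟨Continuous.integrable_of_hasCompactSupport
      (continuous_of_contDiff (by unfold fluxDensity; fun_prop))
      (HasCompactSupport.intro (isCompact_closedBall (0 : E4) (3 / c)) fun x hx => ?_), ?_⟩
    · rw [mem_closedBall_zero_iff, not_le, div_lt_iff₀' hc] at hx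
      simp only [fluxDensity, h1, pd_const_mul_comp_smul, hz x (Or.inr hx), mul_zero,
        Finset.sum_const_zero, add_zero]
    · rw [heq, integral_fluxDensity_rescale u p hc (inv_mul_cancel₀ hc.ne')]
      exact hM _ _ (h.rescale (inv_pos.2 hc))
  have hsplit : fluxDensity U P (shell a b) = fun x => fluxDensity U P (fun y => cut (a • y)) x -
      fluxDensity U P (fun y => cut (b • y)) x := by
    ext x
    have h1 : ∀ k, pd k (shell a b) =
        fun x => pd k (fun y => cut (a • y)) x - pd k (fun y => cut (b • y)) x := fun k =>
      pd_sub (contDiff_cut_smul a) (contDiff_cut_smul b)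
    have h2 : ∀ k, pd k (pd k (shell a b)) =
        fun x => pd k (pd k (fun y => cut (a • y))) x - pd k (pd k (fun y => cut (b • y))) x :=
      fun k => by
        rw [h1, pd_sub (contDiff_pd k (contDiff_cut_smul a)) (contDiff_pd k (contDiff_cut_smul b))]
    simp only [fluxDensity, h2]
    simp only [h1, mul_sub, Finset.sum_sub_distrib]
    ring
  have hle : ∫ x, shell a b x * ∑ i, ∑ j, pd i (U j) x ^ 2 ≤ 2 * M := by
    rw [hen, hsplit, integral_sub (flux a ha le_rfl).1 (flux b hb hba).1]
    linarith [(abs_le.1 (flux a ha le_rfl).2).2, (abs_le.1 (flux b hb hba).2).1]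
  have hsh : Integrable fun x => shell a b x * ∑ i, ∑ j, pd i (U j) x ^ 2 :=
    Continuous.integrable_of_hasCompactSupport (continuous_of_contDiff (by fun_prop)) hφc.mul_right
  have hmeas : MeasurableSet {x : E4 | 3 ≤ a * ‖x‖ ∧ b * ‖x‖ ≤ 2} :=
    ((isClosed_le continuous_const (continuous_const.mul continuous_norm)).inter
      (isClosed_le (continuous_const.mul continuous_norm) continuous_const)).measurableSet
  have hcongr : Set.EqOn (fun x => shell a b x * ∑ i, ∑ j, pd i (U j) x ^ 2)
      (fun x => ∑ i, ∑ j, pd i (u j) x ^ 2) {x : E4 | 3 ≤ a * ‖x‖ ∧ b * ‖x‖ ≤ 2} := fun x hx => by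
    simp only [shell_eq_one ha hb hx.1 hx.2, one_mul, hpd _ _ x (hmem x (by linarith [hx.1]))]
  refine ⟨hsh.integrableOn.congr_fun hcongr hmeas, ?_⟩
  rw [← setIntegral_congr_fun hmeas hcongr]
  refine (setIntegral_le_integral hsh (Eventually.of_forall fun x => ?_)).trans hle
  exact mul_nonneg (shell_nonneg hb hab x) (by positivity)

/-- The Dirichlet energy of a solution bounded by `C / |x|` is finite. -/
lemma IsSol.integrable_energy {C : ℝ} {u : Fin 4 → E4 → ℝ} {p : E4 → ℝ} (hC : 0 ≤ C)
    (h : IsSol C u p) : Integrable fun x => ∑ i, ∑ j, pd i (u j) x ^ 2 := by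
  obtain ⟨M, hM⟩ := exists_flux_bound hC
  set s : ℕ → Set E4 := fun n => {x | 3 ≤ (n + 2 : ℝ) * ‖x‖ ∧ (1 / (n + 2) : ℝ) * ‖x‖ ≤ 2} with hs
  have key := fun n : ℕ => h.setIntegral_energy_le hM (a := n + 2) (b := 1 / (n + 2))
    (by positivity) (by
      rw [mul_one_div, div_le_iff₀ (by positivity)]
      nlinarith [(Nat.cast_nonneg n : (0 : ℝ) ≤ n)])
  have hcover : AECover volume atTop s := by
    refine ⟨?_, fun n => ((isClosed_le continuous_const
      (continuous_const.mul continuous_norm)).inter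
      (isClosed_le (continuous_const.mul continuous_norm) continuous_const)).measurableSet⟩
    filter_upwards [ae_ne_zero] with x hx
    have hx0 : 0 < ‖x‖ := norm_pos_iff.2 hx
    filter_upwards [tendsto_natCast_atTop_atTop.eventually_ge_atTop (3 / ‖x‖),
      tendsto_natCast_atTop_atTop.eventually_ge_atTop ‖x‖] with n h1 h2
    rw [div_le_iff₀ hx0] at h1
    refine ⟨by linarith, ?_⟩
    rw [one_div_mul_eq_div, div_le_iff₀ (by positivity)]
    linarith
  exact hcover.integrable_of_integral_bounded_of_nonneg_ae (2 * M) (fun n => (key n).1)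
    (Eventually.of_forall fun x => by positivity) (Eventually.of_forall fun n => (key n).2)

lemma IsSol.of_vector_field {C : ℝ} {u : E4 → E4} {p : E4 → ℝ}
    (hu : ContDiffOn ℝ ∞ u {x | x ≠ 0}) (hp : ContDiffOn ℝ ∞ p {x | x ≠ 0})
    (hNS : ∀ x, x ≠ 0 → ∀ j, -(∑ i, pd i (pd i fun z => u z j) x) +
      (∑ i, u x i * pd i (fun z => u z j) x) + pd j p x = 0)
    (hdiv : ∀ x, x ≠ 0 → ∑ i, pd i (fun z => u z i) x = 0)
    (hbound : ∀ x, x ≠ 0 → ‖u x‖ ≤ C / ‖x‖) : IsSol C (fun j x => u x j) p :=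
  ⟨fun j => contDiffOn_euclidean.1 hu j, hp, hNS, hdiv, fun x hx j =>
    (PiLp.norm_apply_le (u x) j).trans (hbound x hx)⟩

end SteadyNS

/-- **Finite Dirichlet energy in dimension four.**  If `(u, p)` is a smooth solution of
the steady Navier-Stokes equations on `ℝ⁴ \ {0}` with `|u(x)| ≤ C/|x|`, then
`∫_{ℝ⁴} |∇u(x)|² dx < ∞`, where `|∇u|² = ∑_{i,j} (∂ᵢuⱼ)²`. -/
theorem steady_NS_dim4_finite_energy
    (u : EuclideanSpace ℝ (Fin 4) → EuclideanSpace ℝ (Fin 4))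
    (p : EuclideanSpace ℝ (Fin 4) → ℝ)
    (hu : ContDiffOn ℝ (⊤ : ℕ∞) u {x : EuclideanSpace ℝ (Fin 4) | x ≠ 0})
    (hp : ContDiffOn ℝ (⊤ : ℕ∞) p {x : EuclideanSpace ℝ (Fin 4) | x ≠ 0})
    (hNS : ∀ x : EuclideanSpace ℝ (Fin 4), x ≠ 0 → ∀ j : Fin 4,
      -(∑ i : Fin 4, fderiv ℝ (fun y => fderiv ℝ (fun z => u z j) y
            (EuclideanSpace.single i 1)) x (EuclideanSpace.single i 1)) +
        (∑ i : Fin 4, u x i * fderiv ℝ (fun z => u z j) x (EuclideanSpace.single i 1)) +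
        fderiv ℝ p x (EuclideanSpace.single j 1) = 0)
    (hdiv : ∀ x : EuclideanSpace ℝ (Fin 4), x ≠ 0 →
      ∑ i : Fin 4, fderiv ℝ (fun z => u z i) x (EuclideanSpace.single i 1) = 0)
    (C : ℝ) (hC : 0 < C)
    (hbound : ∀ x : EuclideanSpace ℝ (Fin 4), x ≠ 0 → ‖u x‖ ≤ C / ‖x‖) :
    MeasureTheory.Integrable
      (fun x : EuclideanSpace ℝ (Fin 4) =>
        ∑ i : Fin 4, ∑ j : Fin 4,
          (fderiv ℝ (fun z => u z j) x (EuclideanSpace.single i 1)) ^ 2)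
      MeasureTheory.volume := by
  exact (SteadyNS.IsSol.of_vector_field hu hp hNS hdiv hbound).integrable_energy hC.le
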